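/- arXiv:math/0209316 — 3 statements merged into one kernel-verified Lean document; each statement's English description precedes it below -/
import Mathlib

section
/- For all integers m, m′ > 0 and every class 𝒢 of groups, the graph K₄(m, m′) — the complete graph K₄ with two opposite (nonadjacent) edges replaced by m and m′ parallel copies of themselves, respectively — is good with respect to 𝒢. -/
set_option maxHeartbeats 1000000
set_option synthInstance.maxHeartbeats 400000

attribute [local instance] Classical.propDecidable

noncomputable section

/-- A multigraph: loops and multiple edges are allowed.  Each edge `e` has a
reference orientation, from `src e` to `tgt e`. -/
structure MGraph : Type 1 where
  V : Type
  E : Type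
  src : E → V
  tgt : E → V

/-- A class of groups (a property of groups). -/
abbrev GroupClass : Type 1 := (G : Type) → Group G → Prop

/-- A subgroup-closed class of groups. -/
def SubgroupClosed (𝒢 : GroupClass) : Prop :=
  ∀ (G : Type) [instG : Group G], 𝒢 G instG → ∀ H : Subgroup G, 𝒢 H inferInstance

/-- The number of occurrences of `a` in the list `l`. -/
def countIn {α : Type} (l : List α) (a : α) : ℕ :=
  (l.map fun x => if x = a then 1 else 0).sum

namespace MGraph

/-- A step of a walk: an edge together with a direction of traversal
(`true` = from `src` to `tgt`). -/
abbrev Step (Γ : MGraph) : Type := Γ.E × Bool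

def stepStart (Γ : MGraph) (s : Γ.Step) : Γ.V := if s.2 then Γ.src s.1 else Γ.tgt s.1

def stepEnd (Γ : MGraph) (s : Γ.Step) : Γ.V := if s.2 then Γ.tgt s.1 else Γ.src s.1

/-- `IsWalkFrom Γ a b l`: the list of steps `l` is a walk from `a` to `b`. -/
inductive IsWalkFrom (Γ : MGraph) : Γ.V → Γ.V → List Γ.Step → Prop
  | nil (v : Γ.V) : IsWalkFrom Γ v v []
  | cons {a b : Γ.V} {s : Γ.Step} {l : List Γ.Step} :
      Γ.stepStart s = a → IsWalkFrom Γ (Γ.stepEnd s) b l → IsWalkFrom Γ a b (s :: l)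

section Walks

variable (Γ : MGraph)

/-- The list of edges underlying a walk. -/
def walkEdges (l : List Γ.Step) : List Γ.E := l.map Prod.fst

/-- The list of vertices visited by a walk starting at `a`. -/
def walkVerts (a : Γ.V) (l : List Γ.Step) : List Γ.V := a :: l.map Γ.stepEnd

/-- A closed walk (given as its list of steps) is simple if it is nontrivial and
repeats no edge and no vertex (except that initial vertex = final vertex). -/
def IsSimpleClosed (l : List Γ.Step) : Prop :=
  l ≠ [] ∧ (Γ.walkEdges l).Nodup ∧ (l.map Γ.stepStart).Nodup

section Gain

variable {G : Type} [Group G]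

/-- The gain of a single step, for a gain function `g`. -/
def stepGain (g : Γ.E → G) (s : Γ.Step) : G := if s.2 then g s.1 else (g s.1)⁻¹

/-- The gain of a walk: the product of the gains of its steps, in order. -/
def walkGain (g : Γ.E → G) (l : List Γ.Step) : G := (l.map (Γ.stepGain g)).prod

/-- A gain graph is balanced if every simple closed walk has gain `1`. -/
def IsBalanced (g : Γ.E → G) : Prop :=
  ∀ (v : Γ.V) (l : List Γ.Step),
    Γ.IsWalkFrom v v l → Γ.IsSimpleClosed l → Γ.walkGain g l = 1

end Gain

/-- The mod-2 boundary map from edge chains to vertex chains. -/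
def boundary : (Γ.E →₀ ZMod 2) →ₗ[ZMod 2] (Γ.V →₀ ZMod 2) :=
  Finsupp.lsum (ZMod 2) fun e => Finsupp.lsingle (Γ.src e) + Finsupp.lsingle (Γ.tgt e)

/-- The binary cycle space `Z₁(Γ; ℤ₂)`: mod-2 edge chains with even degree at
every vertex. -/
def cycleSpace : Submodule (ZMod 2) (Γ.E →₀ ZMod 2) := LinearMap.ker Γ.boundary

/-- `B` is a basis of the binary cycle space of `Γ`. -/
def IsCycleBasis (B : Set (Γ.E →₀ ZMod 2)) : Prop :=
  (∀ c ∈ B, c ∈ Γ.cycleSpace) ∧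
  LinearIndependent (ZMod 2) (fun c : B => c.1) ∧
  ∀ c ∈ Γ.cycleSpace, c ∈ Submodule.span (ZMod 2) B

/-- The closed walk `l` is a cyclic orientation of the binary cycle `c`:
it is closed and its edge multiplicities reduced mod 2 give `c`. -/
def IsCyclicOrientation (c : Γ.E →₀ ZMod 2) (l : List Γ.Step) : Prop :=
  (∃ v, Γ.IsWalkFrom v v l) ∧ ∀ e : Γ.E, c e = (countIn (Γ.walkEdges l) e : ZMod 2)

/-- The binary cycle `c` is a circle: it is the (indicator of the) edge set of a
simple closed walk. -/
def IsCircleCycle (c : Γ.E →₀ ZMod 2) : Prop :=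
  ∃ l, Γ.IsSimpleClosed l ∧ Γ.IsCyclicOrientation c l

section Tests

variable {G : Type} [Group G]

/-- `B` passes the Binary Cycle Test: it has a cyclic orientation all of whose
closed walks have gain `1`. -/
def PassesBCT (g : Γ.E → G) (B : Set (Γ.E →₀ ZMod 2)) : Prop :=
  ∀ c ∈ B, ∃ l, Γ.IsCyclicOrientation c l ∧ Γ.walkGain g l = 1

/-- The Binary Cycle Test is valid for the gain graph `(Γ, g, G)`. -/
def BCTValid (g : Γ.E → G) : Prop :=
  (∃ B, Γ.IsCycleBasis B ∧ Γ.PassesBCT g B) → Γ.IsBalanced g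

/-- `c` is a circle whose natural traversal as a simple closed walk has gain 1. -/
def IsBalancedCircleCycle (g : Γ.E → G) (c : Γ.E →₀ ZMod 2) : Prop :=
  ∃ l, Γ.IsSimpleClosed l ∧ Γ.IsCyclicOrientation c l ∧ Γ.walkGain g l = 1

/-- The Circle Test is valid for the gain graph `(Γ, g, G)`: if some basis of the
binary cycle space consists of balanced circles, then the gain graph is balanced. -/
def CircleTestValid (g : Γ.E → G) : Prop :=
  (∃ B, Γ.IsCycleBasis B ∧ ∀ c ∈ B, Γ.IsBalancedCircleCycle g c) → Γ.IsBalanced g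

end Tests

/-- The Binary Cycle Test is valid for `Γ` with respect to the class `𝒢`. -/
def BCTValidFor (𝒢 : GroupClass) : Prop :=
  ∀ (G : Type) [instG : Group G], 𝒢 G instG → ∀ g : Γ.E → G, Γ.BCTValid g

/-- The Circle Test is valid for `Γ` with respect to the class `𝒢`
(`Γ` is a "good" graph for `𝒢`). -/
def CircleTestValidFor (𝒢 : GroupClass) : Prop :=
  ∀ (G : Type) [instG : Group G], 𝒢 G instG → ∀ g : Γ.E → G, Γ.CircleTestValid g

/-- Deletion of a set of edges. -/
def deleteEdges (S : Set Γ.E) : MGraph where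
  V := Γ.V
  E := {e : Γ.E // e ∉ S}
  src e := Γ.src e.1
  tgt e := Γ.tgt e.1

/-- The relation identifying the two endpoints of each edge of `S`. -/
def contractRel (S : Set Γ.E) : Γ.V → Γ.V → Prop :=
  fun x y => ∃ e ∈ S, Γ.src e = x ∧ Γ.tgt e = y

/-- Contraction `Γ/S`: vertices in the same component of `(V, S)` are identified
and the edges of `S` are deleted. -/
def contract (S : Set Γ.E) : MGraph where
  V := Quot (Γ.contractRel S)
  E := {e : Γ.E // e ∉ S}
  src e := Quot.mk _ (Γ.src e.1)
  tgt e := Quot.mk _ (Γ.tgt e.1)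

/-- The subgraph with vertex set `U` and edge set the edges of `T` having both
endpoints in `U`. -/
def subgraph (U : Set Γ.V) (T : Set Γ.E) : MGraph where
  V := U
  E := {e : Γ.E // e ∈ T ∧ Γ.src e ∈ U ∧ Γ.tgt e ∈ U}
  src e := ⟨Γ.src e.1, e.2.2.1⟩
  tgt e := ⟨Γ.tgt e.1, e.2.2.2⟩

/-- The set of vertices incident with an edge of `D`. -/
def edgeVerts (D : Set Γ.E) : Set Γ.V := {x | ∃ e ∈ D, Γ.src e = x ∨ Γ.tgt e = x}

/-- The subgraph spanned by an edge set `D`. -/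
def edgeSubgraph (D : Set Γ.E) : MGraph := Γ.subgraph (Γ.edgeVerts D) D

/-- Adjacency of vertices. -/
def Adj (x y : Γ.V) : Prop :=
  ∃ e : Γ.E, (Γ.src e = x ∧ Γ.tgt e = y) ∨ (Γ.src e = y ∧ Γ.tgt e = x)

/-- A graph with no loops. -/
def Loopless : Prop := ∀ e : Γ.E, Γ.src e ≠ Γ.tgt e

/-- A finite graph. -/
def IsFiniteGraph : Prop := Finite Γ.V ∧ Finite Γ.E

/-- A graph is inseparable if any two distinct edges lie in a common circle. -/
def Inseparable : Prop :=
  ∀ e f : Γ.E, e ≠ f →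
    ∃ (v : Γ.V) (l : List Γ.Step), Γ.IsWalkFrom v v l ∧ Γ.IsSimpleClosed l ∧
      e ∈ Γ.walkEdges l ∧ f ∈ Γ.walkEdges l

/-- `D` is (the edge set of) a block of `Γ`: a maximal inseparable subgraph. -/
def IsBlock (D : Set Γ.E) : Prop :=
  (Γ.edgeSubgraph D).Inseparable ∧
  ∀ D', D ⊆ D' → (Γ.edgeSubgraph D').Inseparable → D' = D

/-- The edge set `D` is a circle of `Γ`. -/
def IsCircleSet (D : Set Γ.E) : Prop :=
  ∃ (v : Γ.V) (l : List Γ.Step), Γ.IsWalkFrom v v l ∧ Γ.IsSimpleClosed l ∧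
    D = {e | e ∈ Γ.walkEdges l}

/-- The edge set `D` is a balanced circle for the gain function `g`. -/
def IsBalancedCircleSet {G : Type} [Group G] (g : Γ.E → G) (D : Set Γ.E) : Prop :=
  Γ.IsCircleSet D ∧
  ∀ (v : Γ.V) (l : List Γ.Step), Γ.IsWalkFrom v v l → Γ.IsSimpleClosed l →
    D = {e | e ∈ Γ.walkEdges l} → Γ.walkGain g l = 1

end Walks

/-- An isomorphism of multigraphs (preserving endpoints as unordered pairs). -/
structure Iso (Γ Δ : MGraph) where
  vEquiv : Γ.V ≃ Δ.V
  eEquiv : Γ.E ≃ Δ.E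
  ends_eq : ∀ e : Γ.E,
    s(Δ.src (eEquiv e), Δ.tgt (eEquiv e)) = s(vEquiv (Γ.src e), vEquiv (Γ.tgt e))

/-- `Δ` is a minor of `Γ`: `Δ` is isomorphic to a subgraph of a contraction of `Γ`. -/
def IsMinor (Δ Γ : MGraph) : Prop :=
  ∃ (S : Set Γ.E) (U : Set (Γ.contract S).V) (T : Set (Γ.contract S).E),
    Nonempty (Iso Δ ((Γ.contract S).subgraph U T))

/-- Subdivision of the edge `e₀` into a path of length two. -/
def subdivide (Γ : MGraph) (e₀ : Γ.E) : MGraph where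
  V := Γ.V ⊕ Unit
  E := Γ.E ⊕ Unit
  src := fun e => match e with
    | .inl e => Sum.inl (Γ.src e)
    | .inr _ => Sum.inr ()
  tgt := fun e => match e with
    | .inl e => if e = e₀ then Sum.inr () else Sum.inl (Γ.tgt e)
    | .inr _ => Sum.inl (Γ.tgt e₀)

/-- One subdivision step (up to isomorphism). -/
def SubdivisionStep (A B : MGraph) : Prop :=
  Nonempty (Iso B A) ∨ ∃ e₀ : A.E, Nonempty (Iso B (A.subdivide e₀))

/-- `Δ` is (isomorphic to) a graph obtained from `Γ₀` by subdividing edges. -/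
def IsSubdivisionOf (Δ Γ₀ : MGraph) : Prop :=
  ∃ Δ', Relation.ReflTransGen SubdivisionStep Γ₀ Δ' ∧ Nonempty (Iso Δ Δ')

/-- Two graphs are homeomorphic if both are obtained by subdividing edges of a
common graph. -/
def Homeomorphic (Γ₁ Γ₂ : MGraph) : Prop :=
  ∃ Γ₀, IsSubdivisionOf Γ₁ Γ₀ ∧ IsSubdivisionOf Γ₂ Γ₀

section Ops

variable (Γ : MGraph)

/-- Interchange `u` and `v`. -/
def twistVert (u v x : Γ.V) : Γ.V := if x = u then v else if x = v then u else x

/-- The result of twisting the edge set `A` across `{u, v}`: every endpoint of an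
edge of `A` at `u` is reconnected to `v` and vice versa. -/
def twist (u v : Γ.V) (A : Set Γ.E) : MGraph where
  V := Γ.V
  E := Γ.E
  src e := if e ∈ A then Γ.twistVert u v (Γ.src e) else Γ.src e
  tgt e := if e ∈ A then Γ.twistVert u v (Γ.tgt e) else Γ.tgt e

/-- `x` and `y` are joined by a walk all of whose vertices avoid `u` and `v`. -/
def AvoidConn (u v x y : Γ.V) : Prop :=
  ∃ l, Γ.IsWalkFrom x y l ∧ ∀ z ∈ Γ.walkVerts x l, z ≠ u ∧ z ≠ v

/-- `P` is the vertex set of a union of some, but not all, of the components of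
`Γ ∖ {u, v}` (the data of a Whitney twist across the 2-separation `{u,v}`). -/
def IsWhitneyTwistData (u v : Γ.V) (P : Set Γ.V) : Prop :=
  (∀ x ∈ P, x ≠ u ∧ x ≠ v) ∧
  (∀ x ∈ P, ∀ y, Γ.AvoidConn u v x y → y ∈ P) ∧
  P.Nonempty ∧ (∃ y : Γ.V, y ∉ P ∧ y ≠ u ∧ y ≠ v)

/-- `(v, w, F)` is valid data for extruding the vertex `v`: `w` is a neighbor of
`v` and `F` is a nonempty set of edges joining `v` and `w`. -/
def IsExtrusionData (v w : Γ.V) (F : Set Γ.E) : Prop :=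
  v ≠ w ∧ F.Nonempty ∧
  ∀ e ∈ F, (Γ.src e = v ∧ Γ.tgt e = w) ∨ (Γ.src e = w ∧ Γ.tgt e = v)

/-- Extrusion of a new vertex `v′` from `v`: the edges of `F` are reattached to
join `v′` to `w`, and a new edge joins `v` to `v′`. -/
def extrude (v w : Γ.V) (F : Set Γ.E) : MGraph where
  V := Γ.V ⊕ Unit
  E := Γ.E ⊕ Unit
  src := fun e => match e with
    | .inl e => if e ∈ F ∧ Γ.src e = v then Sum.inr () else Sum.inl (Γ.src e)
    | .inr _ => Sum.inl v
  tgt := fun e => match e with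
    | .inl e => if e ∈ F ∧ Γ.tgt e = v then Sum.inr () else Sum.inl (Γ.tgt e)
    | .inr _ => Sum.inr ()

end Ops

/-- `Δ` is obtained from `Γ` by extruding a vertex (up to isomorphism). -/
def IsExtrusionOf (Δ Γ : MGraph) : Prop :=
  ∃ (v w : Γ.V) (F : Set Γ.E),
    Γ.IsExtrusionData v w F ∧ Nonempty (Iso Δ (Γ.extrude v w F))

/-- `Γ` is extrusion-irreducible: it is not obtainable by extrusion from a
smaller graph. -/
def ExtrusionIrreducible (Γ : MGraph) : Prop := ¬ ∃ Δ : MGraph, IsExtrusionOf Γ Δ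

/-- `Δ` is obtained from `Γ₀` by a (possibly empty) sequence of extrusions,
up to isomorphism. -/
def ObtainedByExtrusions (Δ Γ₀ : MGraph) : Prop :=
  ∃ Δ', Relation.ReflTransGen (fun A B => IsExtrusionOf B A) Γ₀ Δ' ∧ Nonempty (Iso Δ Δ')

section Bridges

variable (Γ : MGraph)

/-- The walk `l` is internally disjoint from `{u, v}`. -/
def IntDisjWalk (u v : Γ.V) (l : List Γ.Step) : Prop :=
  ∀ z ∈ (l.map Γ.stepEnd).dropLast, z ≠ u ∧ z ≠ v

/-- Two edges lie in a common walk internally disjoint from `{u, v}`. -/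
def InBridgeRel (u v : Γ.V) (e f : Γ.E) : Prop :=
  ∃ (a b : Γ.V) (l : List Γ.Step), Γ.IsWalkFrom a b l ∧ Γ.IntDisjWalk u v l ∧
    e ∈ Γ.walkEdges l ∧ f ∈ Γ.walkEdges l

/-- `D` is (the edge set of) a bridge of `{u, v}`: a maximal set of edges any two
of which lie in a common walk internally disjoint from `{u, v}`. -/
def IsBridge (u v : Γ.V) (D : Set Γ.E) : Prop :=
  D.Nonempty ∧ (∀ e ∈ D, ∀ f ∈ D, Γ.InBridgeRel u v e f) ∧
  ∀ D', D ⊆ D' → (∀ e ∈ D', ∀ f ∈ D', Γ.InBridgeRel u v e f) → D' = D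

/-- The set `A` of vertices is connected using only edges of `D`, within `A`. -/
def SetConnWith (D : Set Γ.E) (A : Set Γ.V) : Prop :=
  ∀ x ∈ A, ∀ y ∈ A, ∃ l, Γ.IsWalkFrom x y l ∧ (∀ s ∈ l, s.1 ∈ D) ∧
    ∀ z ∈ Γ.walkVerts x l, z ∈ A

/-- The subgraph with edge set `D` has `2P_{2uv}` (a four-circle with `u`, `v` as
opposite vertices) as a minor rooted at `u` and `v`, expressed by branch sets. -/
def HasRooted2P2Minor (u v : Γ.V) (D : Set Γ.E) : Prop :=
  ∃ β : Fin 4 → Set Γ.V,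
    (∀ i j, i ≠ j → Disjoint (β i) (β j)) ∧
    (∀ i, (β i).Nonempty ∧ Γ.SetConnWith D (β i)) ∧
    u ∈ β 0 ∧ v ∈ β 2 ∧
    ∀ i : Fin 4, ∃ e ∈ D,
      (Γ.src e ∈ β i ∧ Γ.tgt e ∈ β (i + 1)) ∨ (Γ.src e ∈ β (i + 1) ∧ Γ.tgt e ∈ β i)

/-- Removing the vertex `w` disconnects the subgraph with edge set `D`. -/
def SeparatesBridge (D : Set Γ.E) (w : Γ.V) : Prop :=
  ∃ x ∈ Γ.edgeVerts D, ∃ y ∈ Γ.edgeVerts D, x ≠ w ∧ y ≠ w ∧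
    ¬ ∃ l, Γ.IsWalkFrom x y l ∧ (∀ s ∈ l, s.1 ∈ D) ∧ ∀ z ∈ Γ.walkVerts x l, z ≠ w

end Bridges

/-! ### Particular graphs -/

/-- `K₁°`: one vertex with one loop. -/
@[reducible] def loopGraph : MGraph where
  V := Unit
  E := Unit
  src _ := ()
  tgt _ := ()

/-- `mK₂`: two vertices joined by `m` parallel edges. -/
@[reducible] def banana (m : ℕ) : MGraph where
  V := Bool
  E := Fin m
  src _ := false
  tgt _ := true

/-- `C_l(m₁, …, m_l)`: a circle of length `l` whose `i`-th edge is replaced by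
`m i` parallel copies. -/
@[reducible] def multiCircle (l : ℕ) (m : Fin l → ℕ) : MGraph where
  V := Fin l
  E := Σ i : Fin l, Fin (m i)
  src e := e.1
  tgt e := ⟨(e.1.1 + 1) % l, Nat.mod_lt _ e.1.pos⟩

/-- `2C_n`: the circle of length `n` with every edge doubled. -/
@[reducible] def twoCircle (n : ℕ) : MGraph := multiCircle n fun _ => 2

/-- `K₄(m, m′)`: `K₄` with two opposite (nonadjacent) edges replaced by `m` and
`m′` parallel copies respectively. -/
@[reducible] def K4m (m m' : ℕ) : MGraph where
  V := Fin 4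
  E := (Fin m ⊕ Fin m') ⊕ Fin 4
  src := fun e => match e with
    | .inl (.inl _) => 0
    | .inl (.inr _) => 2
    | .inr j => ![0, 0, 1, 1] j
  tgt := fun e => match e with
    | .inl (.inl _) => 1
    | .inl (.inr _) => 3
    | .inr j => ![2, 3, 2, 3] j

/-- `K₄''`: `K₄` with two adjacent edges doubled. -/
@[reducible] def K4dd : MGraph where
  V := Fin 4
  E := Fin 8
  src := ![0, 0, 0, 0, 0, 1, 1, 2]
  tgt := ![1, 1, 2, 2, 3, 2, 3, 3]

/-- The `n`-spoke wheel `W_n`: rim vertices `Fin n` and a hub; `inl i` is the rim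
edge from `v_i` to `v_{i+1}` and `inr i` is the spoke from the hub to `v_i`. -/
@[reducible] def wheel (n : ℕ) : MGraph where
  V := Fin n ⊕ Unit
  E := Fin n ⊕ Fin n
  src := fun e => match e with
    | .inl i => Sum.inl i
    | .inr _ => Sum.inr ()
  tgt := fun e => match e with
    | .inl i => Sum.inl ⟨(i.1 + 1) % n, Nat.mod_lt _ i.pos⟩
    | .inr i => Sum.inl i

instance (n : ℕ) : Finite ((wheel n).E) := inferInstanceAs (Finite (Fin n ⊕ Fin n))

/-- The indicator of an edge set, as a binary chain. -/
def indicatorCycle (Γ : MGraph) [Finite Γ.E] (D : Set Γ.E) : Γ.E →₀ ZMod 2 :=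
  Finsupp.equivFunOnFinite.symm fun e => if e ∈ D then 1 else 0

/-- The edge set of the Hamiltonian circle of `W_n` omitting the rim edge `r`:
all rim edges except `r`, together with the two spokes at the ends of `r`. -/
def wheelHamSet (n : ℕ) (r : Fin n) : Set (wheel n).E :=
  {e | Sum.elim (fun j : Fin n => j ≠ r)
      (fun j : Fin n => j = r ∨ j = ⟨(r.1 + 1) % n, Nat.mod_lt _ r.pos⟩) e}

/-- The set of (indicators of) the `n` Hamiltonian circles of the wheel `W_n`. -/
def wheelHamBasis (n : ℕ) : Set ((wheel n).E →₀ ZMod 2) :=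
  {c | ∃ r : Fin n, c = indicatorCycle (wheel n) (wheelHamSet n r)}

/-- A theta graph: a graph homeomorphic to a triple link. -/
def IsThetaGraph (Δ : MGraph) : Prop := Homeomorphic Δ (banana 3)

end MGraph

end
namespace K4proof

open MGraph

theorem walk_nil {Γ : MGraph} {a b : Γ.V} : Γ.IsWalkFrom a b [] ↔ a = b := by
  constructor
  · intro h; cases h; rfl
  · rintro rfl; exact .nil _

theorem walk_cons {Γ : MGraph} {a b : Γ.V} {s : Γ.Step} {l : List Γ.Step} :
    Γ.IsWalkFrom a b (s :: l) ↔ Γ.stepStart s = a ∧ Γ.IsWalkFrom (Γ.stepEnd s) b l := by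
  constructor
  · intro h; cases h with | cons h1 h2 => exact ⟨h1, h2⟩
  · rintro ⟨h1, h2⟩; exact .cons h1 h2

/-- Switching a gain function by a potential. -/
def switch (Γ : MGraph) {G : Type} [Group G] (g : Γ.E → G) (θ : Γ.V → G) (e : Γ.E) : G :=
  θ (Γ.src e) * g e * (θ (Γ.tgt e))⁻¹

theorem walkGain_switch (Γ : MGraph) {G : Type} [Group G] (g : Γ.E → G) (θ : Γ.V → G)
    {a b : Γ.V} {l : List Γ.Step} (h : Γ.IsWalkFrom a b l) :
    Γ.walkGain (switch Γ g θ) l = θ a * Γ.walkGain g l * (θ b)⁻¹ := by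
  induction h with
  | nil v => simp [walkGain]
  | @cons a b s l hs _ ih =>
    subst hs
    obtain ⟨e, d⟩ := s
    simp only [walkGain, List.map_cons, List.prod_cons] at ih ⊢
    rw [ih]
    cases d <;> simp [stepGain, switch, stepStart, stepEnd, mul_assoc]

theorem walkGain_switch_closed (Γ : MGraph) {G : Type} [Group G] (g : Γ.E → G) (θ : Γ.V → G)
    {a : Γ.V} {l : List Γ.Step} (h : Γ.IsWalkFrom a a l) :
    Γ.walkGain (switch Γ g θ) l = 1 ↔ Γ.walkGain g l = 1 := by
  rw [walkGain_switch Γ g θ h]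
  constructor
  · intro h
    have := mul_inv_eq_one.mp h
    simpa using this
  · intro h; simp [h]

theorem sum_count {E : Type} [Fintype E] (φ : E → ZMod 2) (L : List E) :
    ∑ e, (countIn L e : ZMod 2) * φ e = (L.map φ).sum := by
  induction L with
  | nil => simp [countIn]
  | cons a L ih =>
    simp only [countIn, List.map_cons, List.sum_cons] at ih ⊢
    rw [← ih]
    push_cast
    simp [add_mul, Finset.sum_add_distrib]

section
variable {m m' : ℕ}

theorem walk0 {b : Fin 4} {s : (K4m m m').Step} {l : List (K4m m m').Step}
    (h : (K4m m m').IsWalkFrom (0 : Fin 4) b (s :: l)) :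
    (∃ i, s = (Sum.inl (Sum.inl i), true) ∧ (K4m m m').stepStart s = (0 : Fin 4) ∧
        (K4m m m').IsWalkFrom (1 : Fin 4) b l) ∨
    (s = (Sum.inr 0, true) ∧ (K4m m m').stepStart s = (0 : Fin 4) ∧
        (K4m m m').IsWalkFrom (2 : Fin 4) b l) ∨
    (s = (Sum.inr 1, true) ∧ (K4m m m').stepStart s = (0 : Fin 4) ∧
        (K4m m m').IsWalkFrom (3 : Fin 4) b l) := by
  rw [walk_cons] at h
  obtain ⟨h, h'⟩ := h
  obtain ⟨(i | j) | k, d⟩ := s <;> try fin_cases k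
  all_goals cases d <;> simp_all [stepStart, stepEnd]

theorem walk1 {b : Fin 4} {s : (K4m m m').Step} {l : List (K4m m m').Step}
    (h : (K4m m m').IsWalkFrom (1 : Fin 4) b (s :: l)) :
    (∃ i, s = (Sum.inl (Sum.inl i), false) ∧ (K4m m m').stepStart s = (1 : Fin 4) ∧
        (K4m m m').IsWalkFrom (0 : Fin 4) b l) ∨
    (s = (Sum.inr 2, true) ∧ (K4m m m').stepStart s = (1 : Fin 4) ∧
        (K4m m m').IsWalkFrom (2 : Fin 4) b l) ∨
    (s = (Sum.inr 3, true) ∧ (K4m m m').stepStart s = (1 : Fin 4) ∧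
        (K4m m m').IsWalkFrom (3 : Fin 4) b l) := by
  rw [walk_cons] at h
  obtain ⟨h, h'⟩ := h
  obtain ⟨(i | j) | k, d⟩ := s <;> try fin_cases k
  all_goals cases d <;> simp_all [stepStart, stepEnd]

theorem walk2 {b : Fin 4} {s : (K4m m m').Step} {l : List (K4m m m').Step}
    (h : (K4m m m').IsWalkFrom (2 : Fin 4) b (s :: l)) :
    (∃ i, s = (Sum.inl (Sum.inr i), true) ∧ (K4m m m').stepStart s = (2 : Fin 4) ∧
        (K4m m m').IsWalkFrom (3 : Fin 4) b l) ∨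
    (s = (Sum.inr 0, false) ∧ (K4m m m').stepStart s = (2 : Fin 4) ∧
        (K4m m m').IsWalkFrom (0 : Fin 4) b l) ∨
    (s = (Sum.inr 2, false) ∧ (K4m m m').stepStart s = (2 : Fin 4) ∧
        (K4m m m').IsWalkFrom (1 : Fin 4) b l) := by
  rw [walk_cons] at h
  obtain ⟨h, h'⟩ := h
  obtain ⟨(i | j) | k, d⟩ := s <;> try fin_cases k
  all_goals cases d <;> simp_all [stepStart, stepEnd]

theorem walk3 {b : Fin 4} {s : (K4m m m').Step} {l : List (K4m m m').Step}
    (h : (K4m m m').IsWalkFrom (3 : Fin 4) b (s :: l)) :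
    (∃ i, s = (Sum.inl (Sum.inr i), false) ∧ (K4m m m').stepStart s = (3 : Fin 4) ∧
        (K4m m m').IsWalkFrom (2 : Fin 4) b l) ∨
    (s = (Sum.inr 1, false) ∧ (K4m m m').stepStart s = (3 : Fin 4) ∧
        (K4m m m').IsWalkFrom (0 : Fin 4) b l) ∨
    (s = (Sum.inr 3, false) ∧ (K4m m m').stepStart s = (3 : Fin 4) ∧
        (K4m m m').IsWalkFrom (1 : Fin 4) b l) := by
  rw [walk_cons] at h
  obtain ⟨h, h'⟩ := h
  obtain ⟨(i | j) | k, d⟩ := s <;> try fin_cases k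
  all_goals cases d <;> simp_all [stepStart, stepEnd]

/-- `x h = 1` up to rotation and inversion. -/
theorem word2 {G : Type} [Group G] {x h : G}
    (H : x * h = 1 ∨ h * x = 1 ∨ x⁻¹ * h⁻¹ = 1 ∨ h⁻¹ * x⁻¹ = 1) : x * h = 1 := by
  have key : h * x = 1 → x * h = 1 := fun H => by
    rw [mul_eq_one_iff_eq_inv] at H; simp [H]
  rcases H with H | H | H | H
  · exact H
  · exact key H
  · exact key (by simpa using congrArg (·⁻¹) H)
  · simpa using congrArg (·⁻¹) H

theorem word2' {G : Type} [Group G] {x h : G}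
    (H : x * h⁻¹ = 1 ∨ h⁻¹ * x = 1 ∨ x⁻¹ * h = 1 ∨ h * x⁻¹ = 1) : x = h := by
  have := word2 (x := x) (h := h⁻¹) (by simpa using H)
  exact mul_inv_eq_one.mp this

theorem word3 {G : Type} [Group G] {x h y : G}
    (H : x * (h * y⁻¹) = 1 ∨ h * (y⁻¹ * x) = 1 ∨ y⁻¹ * (x * h) = 1 ∨
      y * (h⁻¹ * x⁻¹) = 1 ∨ h⁻¹ * (x⁻¹ * y) = 1 ∨ x⁻¹ * (y * h⁻¹) = 1) : y = x * h := by
  rcases H with H | H | H | H | H | H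
  · exact (word2' (x := x * h) (h := y) (by simp [mul_assoc, H])).symm
  · have : x * h * y⁻¹ = 1 := by
      have := word2 (x := x) (h := h * y⁻¹) (by simp only [mul_assoc, H, true_or, or_true])
      simpa [mul_assoc] using this
    exact (mul_inv_eq_one.mp this).symm
  · exact (word2' (x := x * h) (h := y) (by simp [H])).symm
  · exact (word2' (x := y) (h := x * h) (by simp [H]))
  · have : h⁻¹ * x⁻¹ * y = 1 := by simpa [mul_assoc] using H
    exact (word2' (x := y) (h := x * h) (by simp [this]))
  · have := word2 (x := x⁻¹) (h := y * h⁻¹) (by simp [H])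
    have := word2 (x := y) (h := h⁻¹ * x⁻¹) (by
      have h2 := word2 (x := y * h⁻¹) (h := x⁻¹) (by simp [this])
      simp only [mul_assoc] at h2
      simp [h2])
    exact (word2' (x := y) (h := x * h) (by simp [this]))

/-- `φ` vanishes on every balanced circle. -/
structure Cond {G : Type} [Group G] (g : (K4m m m').E → G) (φ : (K4m m m').E → ZMod 2) : Prop where
  H1 : ∀ i i', g (.inl (.inl i)) = g (.inl (.inl i')) →
      φ (.inl (.inl i)) + φ (.inl (.inl i')) = 0
  H2 : ∀ i i', g (.inl (.inr i)) = g (.inl (.inr i')) →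
      φ (.inl (.inr i)) + φ (.inl (.inr i')) = 0
  H3 : ∀ i, g (.inl (.inl i)) = 1 → φ (.inl (.inl i)) + φ (.inr 0) + φ (.inr 2) = 0
  H4 : ∀ i, g (.inl (.inl i)) * g (.inr 3) = 1 →
      φ (.inl (.inl i)) + φ (.inr 1) + φ (.inr 3) = 0
  H5 : ∀ j, g (.inl (.inr j)) = 1 → φ (.inl (.inr j)) + φ (.inr 0) + φ (.inr 1) = 0
  H6 : ∀ j, g (.inl (.inr j)) = g (.inr 3) →
      φ (.inl (.inr j)) + φ (.inr 2) + φ (.inr 3) = 0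
  H7 : g (.inr 3) = 1 → φ (.inr 0) + φ (.inr 1) + φ (.inr 2) + φ (.inr 3) = 0
  H8 : ∀ i j, g (.inl (.inl i)) * g (.inl (.inr j)) = 1 →
      φ (.inl (.inl i)) + φ (.inr 2) + φ (.inl (.inr j)) + φ (.inr 1) = 0
  H9 : ∀ i j, g (.inl (.inr j)) = g (.inl (.inl i)) * g (.inr 3) →
      φ (.inl (.inl i)) + φ (.inr 3) + φ (.inl (.inr j)) + φ (.inr 0) = 0

theorem core {G : Type} [Group G] (g : (K4m m m').E → G) (φ : (K4m m m').E → ZMod 2)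
    (h0 : g (.inr 0) = 1) (h1 : g (.inr 1) = 1) (h2 : g (.inr 2) = 1)
    (H : Cond g φ)
    (v : Fin 4) (l : List (K4m m m').Step) (hw : (K4m m m').IsWalkFrom v v l)
    (hs : (l.map (K4m m m').stepStart).Nodup)
    (hg : (K4m m m').walkGain g l = 1) :
    (((K4m m m').walkEdges l).map φ).sum = 0 := by
  obtain ⟨H1, H2, H3, H4, H5, H6, H7, H8, H9⟩ := H
  have hlen : l.length ≤ 4 := by
    have := hs.length_le_card
    simpa using this
  have dd : ∀ x : ZMod 2, x + x = 0 := by decide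
  match l, hlen with
  | [], _ => simp [walkEdges]
  | [s1], _ =>
    simp only [List.map_cons, List.map_nil] at hs
    fin_cases v
    all_goals simp only [Fin.zero_eta, Fin.mk_one, Fin.reduceFinMk] at hw
    all_goals first
      | replace hw := walk0 hw
      | replace hw := walk1 hw
      | replace hw := walk2 hw
      | replace hw := walk3 hw
    all_goals rcases hw with ⟨i1, rfl, hq, hw⟩ | ⟨rfl, hq, hw⟩ | ⟨rfl, hq, hw⟩
    all_goals rw [hq] at hs; clear hq
    all_goals rw [walk_nil] at hw
    all_goals try (exfalso; revert hw; simp; done)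
  | [s1, s2], _ =>
    simp only [List.map_cons, List.map_nil] at hs
    fin_cases v
    all_goals simp only [Fin.zero_eta, Fin.mk_one, Fin.reduceFinMk] at hw
    all_goals first
      | replace hw := walk0 hw
      | replace hw := walk1 hw
      | replace hw := walk2 hw
      | replace hw := walk3 hw
    all_goals rcases hw with ⟨i1, rfl, hq, hw⟩ | ⟨rfl, hq, hw⟩ | ⟨rfl, hq, hw⟩
    all_goals rw [hq] at hs; clear hq
    all_goals first
      | replace hw := walk0 hw
      | replace hw := walk1 hw
      | replace hw := walk2 hw
      | replace hw := walk3 hw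
    all_goals rcases hw with ⟨i2, rfl, hq, hw⟩ | ⟨rfl, hq, hw⟩ | ⟨rfl, hq, hw⟩
    all_goals rw [hq] at hs; clear hq
    all_goals try (exfalso; revert hs; simp; done)
    all_goals rw [walk_nil] at hw
    all_goals try (exfalso; revert hw; simp; done)
    all_goals simp only [walkGain, stepGain, List.map_cons, List.map_nil, List.prod_cons,
      List.prod_nil, h0, h1, h2, mul_one, one_mul, inv_one, if_true, Bool.false_eq_true, if_false,
      inv_eq_one] at hg
    all_goals simp only [walkEdges, List.map_cons, List.map_nil, List.sum_cons, List.sum_nil]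
    all_goals first
      | linear_combination dd _
      | (have hr := H1 _ _ (word2' (by (first | exact .inl hg | exact .inr (.inl hg) | exact .inr (.inr (.inl hg)) | exact .inr (.inr (.inr hg)))))
         linear_combination hr)
      | (have hr := H2 _ _ (word2' (by (first | exact .inl hg | exact .inr (.inl hg) | exact .inr (.inr (.inl hg)) | exact .inr (.inr (.inr hg)))))
         linear_combination hr)
  | [s1, s2, s3], _ =>
    simp only [List.map_cons, List.map_nil] at hs
    fin_cases v
    all_goals simp only [Fin.zero_eta, Fin.mk_one, Fin.reduceFinMk] at hw
    all_goals first
      | replace hw := walk0 hw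
      | replace hw := walk1 hw
      | replace hw := walk2 hw
      | replace hw := walk3 hw
    all_goals rcases hw with ⟨i1, rfl, hq, hw⟩ | ⟨rfl, hq, hw⟩ | ⟨rfl, hq, hw⟩
    all_goals rw [hq] at hs; clear hq
    all_goals first
      | replace hw := walk0 hw
      | replace hw := walk1 hw
      | replace hw := walk2 hw
      | replace hw := walk3 hw
    all_goals rcases hw with ⟨i2, rfl, hq, hw⟩ | ⟨rfl, hq, hw⟩ | ⟨rfl, hq, hw⟩
    all_goals rw [hq] at hs; clear hq
    all_goals try (exfalso; revert hs; simp; done)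
    all_goals first
      | replace hw := walk0 hw
      | replace hw := walk1 hw
      | replace hw := walk2 hw
      | replace hw := walk3 hw
    all_goals rcases hw with ⟨i3, rfl, hq, hw⟩ | ⟨rfl, hq, hw⟩ | ⟨rfl, hq, hw⟩
    all_goals rw [hq] at hs; clear hq
    all_goals try (exfalso; revert hs; simp; done)
    all_goals rw [walk_nil] at hw
    all_goals try (exfalso; revert hw; simp; done)
    all_goals simp only [walkGain, stepGain, List.map_cons, List.map_nil, List.prod_cons,
      List.prod_nil, h0, h1, h2, mul_one, one_mul, inv_one, if_true, Bool.false_eq_true, if_false,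
      inv_eq_one] at hg
    all_goals simp only [walkEdges, List.map_cons, List.map_nil, List.sum_cons, List.sum_nil]
    all_goals first
      | (have hr := H3 _ hg
         linear_combination hr)
      | (have hr := H5 _ hg
         linear_combination hr)
      | (have hr := H4 _ (word2 (by (first | exact .inl hg | exact .inr (.inl hg) | exact .inr (.inr (.inl hg)) | exact .inr (.inr (.inr hg)))))
         linear_combination hr)
      | (have hr := H6 _ (word2' (by (first | exact .inl hg | exact .inr (.inl hg) | exact .inr (.inr (.inl hg)) | exact .inr (.inr (.inr hg)))))
         linear_combination hr)
  | [s1, s2, s3, s4], _ =>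
    simp only [List.map_cons, List.map_nil] at hs
    fin_cases v
    all_goals simp only [Fin.zero_eta, Fin.mk_one, Fin.reduceFinMk] at hw
    all_goals first
      | replace hw := walk0 hw
      | replace hw := walk1 hw
      | replace hw := walk2 hw
      | replace hw := walk3 hw
    all_goals rcases hw with ⟨i1, rfl, hq, hw⟩ | ⟨rfl, hq, hw⟩ | ⟨rfl, hq, hw⟩
    all_goals rw [hq] at hs; clear hq
    all_goals first
      | replace hw := walk0 hw
      | replace hw := walk1 hw
      | replace hw := walk2 hw
      | replace hw := walk3 hw
    all_goals rcases hw with ⟨i2, rfl, hq, hw⟩ | ⟨rfl, hq, hw⟩ | ⟨rfl, hq, hw⟩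
    all_goals rw [hq] at hs; clear hq
    all_goals try (exfalso; revert hs; simp; done)
    all_goals first
      | replace hw := walk0 hw
      | replace hw := walk1 hw
      | replace hw := walk2 hw
      | replace hw := walk3 hw
    all_goals rcases hw with ⟨i3, rfl, hq, hw⟩ | ⟨rfl, hq, hw⟩ | ⟨rfl, hq, hw⟩
    all_goals rw [hq] at hs; clear hq
    all_goals try (exfalso; revert hs; simp; done)
    all_goals first
      | replace hw := walk0 hw
      | replace hw := walk1 hw
      | replace hw := walk2 hw
      | replace hw := walk3 hw
    all_goals rcases hw with ⟨i4, rfl, hq, hw⟩ | ⟨rfl, hq, hw⟩ | ⟨rfl, hq, hw⟩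
    all_goals rw [hq] at hs; clear hq
    all_goals try (exfalso; revert hs; simp; done)
    all_goals rw [walk_nil] at hw
    all_goals try (exfalso; revert hw; simp; done)
    all_goals simp only [walkGain, stepGain, List.map_cons, List.map_nil, List.prod_cons,
      List.prod_nil, h0, h1, h2, mul_one, one_mul, inv_one, if_true, Bool.false_eq_true, if_false,
      inv_eq_one] at hg
    all_goals simp only [walkEdges, List.map_cons, List.map_nil, List.sum_cons, List.sum_nil]
    all_goals first
      | (have hr := H7 hg
         linear_combination hr)
      | (have hr := H8 _ _ (word2 (by (first | exact .inl hg | exact .inr (.inl hg) | exact .inr (.inr (.inl hg)) | exact .inr (.inr (.inr hg)))))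
         linear_combination hr)
      | (have hr := H9 _ _ (word3 (by (first | exact .inl hg | exact .inr (.inl hg) | exact .inr (.inr (.inl hg)) | exact .inr (.inr (.inr (.inl hg))) | exact .inr (.inr (.inr (.inr (.inl hg)))) | exact .inr (.inr (.inr (.inr (.inr hg)))))))
         linear_combination hr)
  | _ :: _ :: _ :: _ :: _ :: _, hl => simp at hl; omega

theorem bd_single (Γ : MGraph) (e : Γ.E) : Γ.boundary (Finsupp.single e 1) =
    Finsupp.single (Γ.src e) 1 + Finsupp.single (Γ.tgt e) 1 := by
  simp [boundary]

theorem bdA (i : Fin m) : (K4m m m').boundary (Finsupp.single (.inl (.inl i)) 1) =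
    (Finsupp.single 0 1 + Finsupp.single 1 1 : Fin 4 →₀ ZMod 2) := bd_single _ _

theorem bdB (i : Fin m') : (K4m m m').boundary (Finsupp.single (.inl (.inr i)) 1) =
    (Finsupp.single 2 1 + Finsupp.single 3 1 : Fin 4 →₀ ZMod 2) := bd_single _ _

theorem bdC (k : Fin 4) : (K4m m m').boundary (Finsupp.single (.inr k) 1) =
    (Finsupp.single (![0, 0, 1, 1] k) 1 + Finsupp.single (![2, 3, 2, 3] k) 1 : Fin 4 →₀ ZMod 2) :=
  bd_single _ _

theorem mem_add3 (Γ : MGraph) {a b c : Γ.E →₀ ZMod 2} {a' b' c' : Γ.V →₀ ZMod 2}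
    (ha : Γ.boundary a = a') (hb : Γ.boundary b = b') (hc : Γ.boundary c = c')
    (h : a' + b' + c' = 0) : a + b + c ∈ Γ.cycleSpace := by
  rw [cycleSpace, LinearMap.mem_ker, map_add, map_add, ha, hb, hc, h]

theorem mem_add4 (Γ : MGraph) {a b c d : Γ.E →₀ ZMod 2} {a' b' c' d' : Γ.V →₀ ZMod 2}
    (ha : Γ.boundary a = a') (hb : Γ.boundary b = b') (hc : Γ.boundary c = c')
    (hd : Γ.boundary d = d')
    (h : a' + b' + c' + d' = 0) : a + b + c + d ∈ Γ.cycleSpace := by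
  rw [cycleSpace, LinearMap.mem_ker, map_add, map_add, map_add, ha, hb, hc, hd, h]

theorem functional_zero {G : Type} [Group G] (g g' : (K4m m m').E → G) (θ : Fin 4 → G)
    (hg' : g' = switch (K4m m m') g θ) (φ : (K4m m m').E → ZMod 2)
    (h0 : g' (.inr 0) = 1) (h1 : g' (.inr 1) = 1) (h2 : g' (.inr 2) = 1)
    (H : Cond g' φ) (B : Set ((K4m m m').E →₀ ZMod 2))
    (hspan : ∀ c ∈ (K4m m m').cycleSpace, c ∈ Submodule.span (ZMod 2) B)
    (hbal : ∀ c ∈ B, (K4m m m').IsBalancedCircleCycle g c)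
    (c : (K4m m m').E →₀ ZMod 2) (hc : c ∈ (K4m m m').cycleSpace) :
    ∑ e, c e * φ e = 0 := by
  have := hspan c hc
  clear hc
  induction this using Submodule.span_induction with
  | mem c hcB =>
    obtain ⟨l, hs, ⟨⟨v, hw⟩, hcount⟩, hgain⟩ := hbal c hcB
    simp only [hcount]
    rw [sum_count]
    refine core g' φ h0 h1 h2 H v l hw hs.2.2 ?_
    rw [hg']
    exact (walkGain_switch_closed _ g θ hw).2 hgain
  | zero => simp
  | add x y _ _ hx hy =>
    simp only [Finsupp.add_apply, add_mul, Finset.sum_add_distrib, hx, hy, add_zero]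
  | smul a x _ hx =>
    simp only [Finsupp.smul_apply, smul_eq_mul, mul_assoc, ← Finset.mul_sum, hx, mul_zero]

theorem triA_mem (i : Fin m) : (Finsupp.single (.inl (.inl i)) 1 + Finsupp.single (.inr 0) 1 +
    Finsupp.single (.inr 2) 1 : (K4m m m').E →₀ ZMod 2) ∈ (K4m m m').cycleSpace := by
  have tt : (1 : ZMod 2) + 1 = 0 := by decide
  refine mem_add3 _ (bdA i) (bdC 0) (bdC 2) ?_
  ext v
  fin_cases v <;> simp [Finsupp.single_apply, tt]

theorem triB_mem (i : Fin m') : (Finsupp.single (.inl (.inr i)) 1 + Finsupp.single (.inr 0) 1 +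
    Finsupp.single (.inr 1) 1 : (K4m m m').E →₀ ZMod 2) ∈ (K4m m m').cycleSpace := by
  have tt : (1 : ZMod 2) + 1 = 0 := by decide
  refine mem_add3 _ (bdB i) (bdC 0) (bdC 1) ?_
  ext v
  fin_cases v <;> simp [Finsupp.single_apply, tt]

theorem quad_mem : (Finsupp.single (.inr 0) 1 + Finsupp.single (.inr 1) 1 +
    Finsupp.single (.inr 2) 1 + Finsupp.single (.inr 3) 1 : (K4m m m').E →₀ ZMod 2) ∈
    (K4m m m').cycleSpace := by
  have tt : (1 : ZMod 2) + 1 = 0 := by decide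
  refine mem_add4 _ (bdC 0) (bdC 1) (bdC 2) (bdC 3) ?_
  ext v
  fin_cases v <;> simp [Finsupp.single_apply, tt]

theorem main_aux {G : Type} [Group G] (g : (K4m m m').E → G)
    (B : Set ((K4m m m').E →₀ ZMod 2))
    (hspan : ∀ c ∈ (K4m m m').cycleSpace, c ∈ Submodule.span (ZMod 2) B)
    (hbal : ∀ c ∈ B, (K4m m m').IsBalancedCircleCycle g c) : (K4m m m').IsBalanced g := by
  let θ : Fin 4 → G := ![1, g (.inr 0) * (g (.inr 2))⁻¹, g (.inr 0), g (.inr 1)]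
  obtain ⟨g', hg'⟩ : ∃ g', g' = switch (K4m m m') g θ := ⟨_, rfl⟩
  have h0 : g' (.inr 0) = 1 := by simp [hg', switch, θ]
  have h1 : g' (.inr 1) = 1 := by simp [hg', switch, θ]
  have h2 : g' (.inr 2) = 1 := by simp [hg', switch, θ]
  have key := fun φ H c hc => functional_zero g g' θ hg' φ h0 h1 h2 H B hspan hbal c hc
  have tt : (1 : ZMod 2) + 1 = 0 := by decide
  obtain ⟨h, hh⟩ : ∃ h, g' (.inr 3) = h := ⟨_, rfl⟩
  -- step 1
  have S1 : (∀ i, g' (.inl (.inl i)) = 1 ∨ g' (.inl (.inl i)) = h⁻¹) ∧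
      (∀ j, g' (.inl (.inr j)) = 1 ∨ g' (.inl (.inr j)) = h) := by
    let φ : (K4m m m').E → ZMod 2 := fun e => match e with
      | .inl (.inl i) => if g' (.inl (.inl i)) = 1 ∨ g' (.inl (.inl i)) = h⁻¹ then 0 else 1
      | .inl (.inr j) => if g' (.inl (.inr j)) = 1 ∨ g' (.inl (.inr j)) = h then 0 else 1
      | .inr _ => 0
    have H : Cond g' φ := by
      constructor
      · intro i i' e
        simp only [φ, e]
        split_ifs <;> simp [tt]
      · intro i i' e
        simp only [φ, e]
        split_ifs <;> simp [tt]
      · intro i e; simp [φ, e]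
      · intro i e
        rw [hh] at e
        simp [φ, mul_eq_one_iff_eq_inv.mp e]
      · intro i e; simp [φ, e]
      · intro i e
        rw [hh] at e
        simp [φ, e]
      · intro e; simp [φ]
      · intro i j e
        have e' := mul_eq_one_iff_eq_inv.mp e
        simp only [φ, e', inv_eq_one, inv_inj]
        split_ifs <;> simp [tt]
      · intro i j e
        rw [hh] at e
        have : (g' (.inl (.inr j)) = 1 ∨ g' (.inl (.inr j)) = h) ↔
            (g' (.inl (.inl i)) = 1 ∨ g' (.inl (.inl i)) = h⁻¹) := by
          rw [e, mul_eq_one_iff_eq_inv, mul_eq_right, or_comm]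
        simp only [φ, this]
        split_ifs <;> simp [tt]
    constructor
    · intro i
      by_contra hi
      have := key φ H _ (triA_mem i)
      simp [add_mul, Finset.sum_add_distrib, φ, hi, Finsupp.single_apply] at this
    · intro j
      by_contra hi
      have := key φ H _ (triB_mem j)
      simp [add_mul, Finset.sum_add_distrib, φ, hi, Finsupp.single_apply] at this
  obtain ⟨SA, SB⟩ := S1
  have hone : h = 1 := by
    by_contra hne
    let φ : (K4m m m').E → ZMod 2 := fun e => match e with
      | .inl (.inl i) => if g' (.inl (.inl i)) = 1 then 0 else 1
      | .inl (.inr j) => if g' (.inl (.inr j)) = 1 then 0 else 1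
      | .inr k => if k = 3 then 1 else 0
    have H : Cond g' φ := by
      constructor
      · intro i i' e
        simp only [φ, e]
        split_ifs <;> simp [tt]
      · intro i i' e
        simp only [φ, e]
        split_ifs <;> simp [tt]
      · intro i e; simp [φ, e]
      · intro i e
        rw [hh] at e
        simp [φ, mul_eq_one_iff_eq_inv.mp e, hne, tt]
      · intro i e; simp [φ, e]
      · intro i e
        rw [hh] at e
        simp [φ, e, hne, tt]
      · intro e; exact absurd (hh.symm.trans e) hne
      · intro i j e
        have e' := mul_eq_one_iff_eq_inv.mp e
        simp only [φ, e', inv_eq_one]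
        split_ifs <;> simp_all
      · intro i j e
        rw [hh] at e
        rcases SA i with a | a
        · have b : g' (.inl (.inr j)) = h := by rw [e, a, one_mul]
          simp [φ, a, b, hne, tt]
        · have b : g' (.inl (.inr j)) = 1 := by rw [e, a, inv_mul_cancel]
          simp [φ, a, b, hne, tt]
    have := key φ H _ quad_mem
    simp [add_mul, Finset.sum_add_distrib, φ, Finsupp.single_apply] at this
  have hall : ∀ e, g' e = 1 := by
    rintro ((i | j) | k)
    · simpa [hone] using SA i
    · simpa [hone] using SB j
    · fin_cases k
      · exact h0
      · exact h1
      · exact h2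
      · exact hh.trans hone
  intro v l hw _
  rw [← walkGain_switch_closed _ g θ hw, ← hg', walkGain]
  apply List.prod_eq_one
  intro x hx
  obtain ⟨s, _, rfl⟩ := List.mem_map.mp hx
  simp [stepGain, hall]

end

end K4proof

/-- For all `m, m′ > 0` and every class `𝒢` of groups, the graph
`K₄(m, m′)` is good with respect to `𝒢`. -/
theorem K4mm_good (𝒢 : GroupClass) (m m' : ℕ) (hm : 0 < m) (hm' : 0 < m') :
    (MGraph.K4m m m').CircleTestValidFor 𝒢 := by
  rintro G _ _ g ⟨B, ⟨_, _, hspan⟩, hbal⟩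
  exact K4proof.main_aux g B hspan hbal
end

section
/- For every m ≥ 2 and every class 𝒢 of groups, the graph C₃(m, 2, 2) — a triangle whose three edges are replaced by m, 2, and 2 parallel copies respectively — is good with respect to 𝒢. Likewise, for all m, m′ ≥ 1, the graph C₃(m, m′, 1) is good with respect to every class 𝒢. -/
set_option maxHeartbeats 1000000
set_option synthInstance.maxHeartbeats 400000

attribute [local instance] Classical.propDecidable

namespace MGraph

/-- The binary chain of a walk. -/
noncomputable def walkChain (Γ : MGraph) (l : List Γ.Step) : Γ.E →₀ ZMod 2 :=
  (l.map fun s => Finsupp.single s.1 1).sum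

theorem walkChain_apply (Γ : MGraph) (l : List Γ.Step) (e : Γ.E) :
    Γ.walkChain l e = (countIn (Γ.walkEdges l) e : ZMod 2) := by
  induction l with
  | nil => simp [walkChain, countIn, walkEdges]
  | cons s l ih =>
    have h1 : Γ.walkChain (s :: l) = Finsupp.single s.1 1 + Γ.walkChain l := by
      simp [walkChain]
    have h2 : countIn (Γ.walkEdges (s :: l)) e
        = (if s.1 = e then 1 else 0) + countIn (Γ.walkEdges l) e := by
      simp [countIn, walkEdges]
    rw [h1, h2, Finsupp.add_apply, ih, Finsupp.single_apply]
    push_cast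
    congr 1

theorem boundary_walkChain (Γ : MGraph) {a b : Γ.V} {l : List Γ.Step}
    (h : Γ.IsWalkFrom a b l) :
    Γ.boundary (Γ.walkChain l) = Finsupp.single a 1 + Finsupp.single b 1 := by
  have two : ∀ y : Γ.V →₀ ZMod 2, y + y = 0 := fun y => by
    ext v
    simpa using CharTwo.add_self_eq_zero (y v)
  induction h with
  | nil v => rw [two]; simp [walkChain]
  | @cons a b s l hs hw ih =>
    have h1 : Γ.walkChain (s :: l) = Finsupp.single s.1 1 + Γ.walkChain l := by
      simp [walkChain]
    have h2 : Γ.boundary (Finsupp.single s.1 1)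
        = Finsupp.single (Γ.stepStart s) 1 + Finsupp.single (Γ.stepEnd s) 1 := by
      rcases s with ⟨e, d⟩
      cases d <;> simp [boundary, stepStart, stepEnd, add_comm]
    rw [h1, map_add, ih, h2, hs, add_assoc, ← add_assoc (Finsupp.single (Γ.stepEnd s) 1),
      two, zero_add]

/-- The sum of a binary cochain along a walk. -/
def walkSum (Γ : MGraph) (x : Γ.E → ZMod 2) (l : List Γ.Step) : ZMod 2 :=
  (l.map fun s => x s.1).sum

theorem linComb_walkChain (Γ : MGraph) (x : Γ.E → ZMod 2) (l : List Γ.Step) :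
    Finsupp.linearCombination (ZMod 2) x (Γ.walkChain l) = Γ.walkSum x l := by
  induction l with
  | nil => simp [walkChain, walkSum]
  | cons s l ih =>
    have h1 : Γ.walkChain (s :: l) = Finsupp.single s.1 1 + Γ.walkChain l := by
      simp [walkChain]
    rw [h1, map_add, ih]
    simp [walkSum]

theorem key {Γ : MGraph} {G : Type} [Group G] {g : Γ.E → G} {B : Set (Γ.E →₀ ZMod 2)}
    (hB : Γ.IsCycleBasis B) (hbal : ∀ c ∈ B, Γ.IsBalancedCircleCycle g c)
    (x : Γ.E → ZMod 2)
    (hx : ∀ v l, Γ.IsWalkFrom v v l → Γ.IsSimpleClosed l → Γ.walkGain g l = 1 →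
      Γ.walkSum x l = 0)
    {v : Γ.V} {l : List Γ.Step} (hl : Γ.IsWalkFrom v v l) : Γ.walkSum x l = 0 := by
  have hmem : Γ.walkChain l ∈ Γ.cycleSpace := by
    rw [cycleSpace, LinearMap.mem_ker, boundary_walkChain Γ hl]
    ext w
    simpa using CharTwo.add_self_eq_zero ((Finsupp.single v 1 : Γ.V →₀ ZMod 2) w)
  have hs := hB.2.2 _ hmem
  have hle : Submodule.span (ZMod 2) B
      ≤ LinearMap.ker (Finsupp.linearCombination (ZMod 2) x) := by
    rw [Submodule.span_le]
    intro c hc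
    obtain ⟨l', hsc, ⟨⟨w, hw⟩, hcount⟩, hg⟩ := hbal c hc
    have : c = Γ.walkChain l' := by
      ext e
      rw [walkChain_apply, hcount]
    rw [SetLike.mem_coe, LinearMap.mem_ker, this, linComb_walkChain]
    exact hx w l' hw hsc hg
  have := hle hs
  rwa [LinearMap.mem_ker, linComb_walkChain] at this

theorem isWalkFrom_cons_iff {Γ : MGraph} {a b : Γ.V} {s : Γ.Step} {l : List Γ.Step} :
    Γ.IsWalkFrom a b (s :: l) ↔ Γ.stepStart s = a ∧ Γ.IsWalkFrom (Γ.stepEnd s) b l := by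
  constructor
  · intro h
    cases h with
    | cons h1 h2 => exact ⟨h1, h2⟩
  · rintro ⟨h1, h2⟩
    exact .cons h1 h2

theorem isWalkFrom_nil_iff {Γ : MGraph} {a b : Γ.V} :
    Γ.IsWalkFrom a b [] ↔ a = b := by
  constructor
  · intro h
    cases h
    rfl
  · rintro rfl
    exact .nil _

/-- The next vertex of the triangle. -/
theorem tri_tgt (m : Fin 3 → ℕ) (e : (multiCircle 3 m).E) :
    (multiCircle 3 m).tgt e = e.1 + 1 := by
  apply Fin.ext
  simp [Fin.val_add]

theorem tri_start (m : Fin 3 → ℕ) (e : (multiCircle 3 m).E) (d : Bool) :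
    (multiCircle 3 m).stepStart (e, d) = cond d e.1 (e.1 + 1) := by
  cases d
  · exact (if_neg (by simp)).trans (tri_tgt m e)
  · exact if_pos rfl

theorem tri_end (m : Fin 3 → ℕ) (e : (multiCircle 3 m).E) (d : Bool) :
    (multiCircle 3 m).stepEnd (e, d) = cond d (e.1 + 1) e.1 := by
  cases d
  · exact if_neg (by simp)
  · exact (if_pos rfl).trans (tri_tgt m e)

theorem fin_one : ∀ (d : Bool) (i : Fin 3), cond d (i + 1) i ≠ cond d i (i + 1) := by
  decide

theorem fin_two : ∀ (d d' : Bool) (i j : Fin 3), cond d' j (j + 1) = cond d (i + 1) i →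
    cond d' (j + 1) j = cond d i (i + 1) → i = j ∧ d' = !d := by
  decide

theorem fin_three : ∀ (d d' d'' : Bool) (i j r : Fin 3),
    cond d' j (j + 1) = cond d (i + 1) i →
    cond d'' r (r + 1) = cond d' (j + 1) j →
    cond d'' (r + 1) r = cond d i (i + 1) →
    cond d i (i + 1) ≠ cond d' j (j + 1) →
    cond d i (i + 1) ≠ cond d'' r (r + 1) →
    cond d' j (j + 1) ≠ cond d'' r (r + 1) →
    d' = d ∧ d'' = d ∧
      (d = true ∧ ((i = 0 ∧ j = 1 ∧ r = 2) ∨ (i = 1 ∧ j = 2 ∧ r = 0) ∨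
        (i = 2 ∧ j = 0 ∧ r = 1)) ∨
      d = false ∧ ((i = 0 ∧ j = 2 ∧ r = 1) ∨ (i = 1 ∧ j = 0 ∧ r = 2) ∨
        (i = 2 ∧ j = 1 ∧ r = 0))) := by
  intro d d' d'' i j r
  fin_cases i <;> fin_cases j <;> fin_cases r <;> cases d <;> cases d' <;> cases d'' <;> simp

theorem mul_rot {G : Type} [Group G] (a b c : G) : a * b * c = 1 ↔ b * c * a = 1 := by
  constructor <;> intro h
  · have := eq_inv_of_mul_eq_one_left h
    have h2 : a = (b * c)⁻¹ := eq_inv_of_mul_eq_one_left (by rw [← mul_assoc]; exact h)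
    rw [h2]; simp
  · have h2 : a = (b * c)⁻¹ := eq_inv_of_mul_eq_one_right h
    rw [h2]; group

theorem mul_rev {G : Type} [Group G] (a b c : G) :
    a⁻¹ * b⁻¹ * c⁻¹ = 1 ↔ c * b * a = 1 := by
  rw [← inv_eq_one (a := c * b * a)]
  simp [mul_assoc]

theorem classify (m : Fin 3 → ℕ) {v : Fin 3} {l : List (multiCircle 3 m).Step}
    (hw : (multiCircle 3 m).IsWalkFrom v v l) (hs : (multiCircle 3 m).IsSimpleClosed l)
    {G : Type} [Group G] (g : (multiCircle 3 m).E → G) :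
    (∃ e f : (multiCircle 3 m).E, e.1 = f.1 ∧
      (∀ x, (multiCircle 3 m).walkSum x l = x e + x f) ∧
      ((multiCircle 3 m).walkGain g l = 1 ↔ g e = g f)) ∨
    (∃ e f h : (multiCircle 3 m).E, e.1 = 0 ∧ f.1 = 1 ∧ h.1 = 2 ∧
      (∀ x, (multiCircle 3 m).walkSum x l = x e + x f + x h) ∧
      ((multiCircle 3 m).walkGain g l = 1 ↔ g e * g f * g h = 1)) := by
  obtain ⟨hne, hed, hst⟩ := hs
  have hlen : l.length ≤ 3 := by
    have := hst.length_le_card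
    simpa using this
  match l, hne, hlen with
  | [s], _, _ =>
    exfalso
    obtain ⟨e, d⟩ := s
    rw [isWalkFrom_cons_iff, isWalkFrom_nil_iff] at hw
    obtain ⟨h1, h2⟩ := hw
    rw [← h1, tri_start, tri_end] at h2
    exact fin_one _ _ h2
  | [s, t], _, _ =>
    left
    obtain ⟨e, d⟩ := s
    obtain ⟨f, d'⟩ := t
    rw [isWalkFrom_cons_iff, isWalkFrom_cons_iff, isWalkFrom_nil_iff] at hw
    obtain ⟨h1, h2, h3⟩ := hw
    rw [← h1, tri_start, tri_end] at h3
    rw [tri_start, tri_end] at h2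
    have hk := fin_two _ _ _ _ h2 h3
    refine ⟨e, f, hk.1, fun x => by simp [walkSum], ?_⟩
    rw [hk.2]
    cases d
    · simp [walkGain, stepGain, inv_mul_eq_one]
    · simp [walkGain, stepGain, mul_inv_eq_one]
  | [s, t, u], _, _ =>
    right
    obtain ⟨e, d⟩ := s
    obtain ⟨f, d'⟩ := t
    obtain ⟨k, d''⟩ := u
    rw [isWalkFrom_cons_iff, isWalkFrom_cons_iff, isWalkFrom_cons_iff,
      isWalkFrom_nil_iff] at hw
    obtain ⟨h1, h2, h3, h4⟩ := hw
    rw [← h1, tri_start, tri_end] at h4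
    rw [tri_start, tri_end] at h2 h3
    rw [List.map_cons, List.map_cons, List.map_cons, tri_start, tri_start, tri_start] at hst
    simp only [List.map_nil, List.nodup_cons, List.mem_cons, List.not_mem_nil, or_false,
      not_or] at hst
    have hk := fin_three _ _ _ _ _ _ h2 h3 h4 hst.1.1 hst.1.2 hst.2.1
    obtain ⟨rfl, rfl, hk⟩ := hk
    rcases hk with ⟨rfl, hk | hk | hk⟩ | ⟨rfl, hk | hk | hk⟩
    · refine ⟨e, f, k, hk.1, hk.2.1, hk.2.2, fun x => by simp [walkSum]; ring, ?_⟩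
      simp [walkGain, stepGain, ← mul_assoc]
    · refine ⟨k, e, f, hk.2.2, hk.1, hk.2.1, fun x => by simp [walkSum]; ring, ?_⟩
      rw [mul_rot]
      simp [walkGain, stepGain, ← mul_assoc]
    · refine ⟨f, k, e, hk.2.1, hk.2.2, hk.1, fun x => by simp [walkSum]; ring, ?_⟩
      rw [← mul_rot]
      simp [walkGain, stepGain, ← mul_assoc]
    · refine ⟨e, k, f, hk.1, hk.2.2, hk.2.1, fun x => by simp [walkSum]; ring, ?_⟩
      rw [mul_rot, ← mul_rev]
      simp [walkGain, stepGain, ← mul_assoc]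
    · refine ⟨f, e, k, hk.2.1, hk.1, hk.2.2, fun x => by simp [walkSum]; ring, ?_⟩
      rw [← mul_rot, ← mul_rev]
      simp [walkGain, stepGain, ← mul_assoc]
    · refine ⟨k, f, e, hk.2.2, hk.2.1, hk.1, fun x => by simp [walkSum]; ring, ?_⟩
      rw [← mul_rev]
      simp [walkGain, stepGain, ← mul_assoc]

/-- If triangle balance amounts to equality of labels on the two classes other than `k`,
the circle test is valid. -/
theorem labels (m : Fin 3 → ℕ) {G : Type} [Group G] (g : (multiCircle 3 m).E → G)
    {B : Set ((multiCircle 3 m).E →₀ ZMod 2)}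
    (hB : (multiCircle 3 m).IsCycleBasis B)
    (hbal : ∀ c ∈ B, (multiCircle 3 m).IsBalancedCircleCycle g c)
    (k : Fin 3) (hk0 : k = 1 ∨ k = 2) (lab : (multiCircle 3 m).E → G)
    (hk : ∀ e f : (multiCircle 3 m).E, e.1 = k → f.1 = k → g e = g f)
    (hd : ∀ e f : (multiCircle 3 m).E, e.1 = f.1 → e.1 ≠ k → (g e = g f ↔ lab e = lab f))
    (ht : ∀ e f h : (multiCircle 3 m).E, e.1 = 0 → f.1 = 1 → h.1 = 2 →
      (g e * g f * g h = 1 ↔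
        (k = 1 ∧ lab e = lab h) ∨ (k = 2 ∧ lab e = lab f))) :
    (multiCircle 3 m).IsBalanced g := by
  have one : (1 : ZMod 2) + 1 = 0 := by decide
  have main : ∀ (h0 : G) v l, (multiCircle 3 m).IsWalkFrom v v l →
      (multiCircle 3 m).walkSum (fun e => if e.1 = k then 0 else if lab e = h0 then 1 else 0) l
        = 0 := by
    intro h0 v l hl
    refine key hB hbal _ ?_ hl
    intro v l hl hs hg
    rcases classify m hl hs g with ⟨e, f, hef, hsum, hgain⟩ | ⟨e, f, h, he, hf, hh, hsum, hgain⟩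
    · rw [hsum]
      by_cases hek : e.1 = k
      · simp [hek, ← hef]
      · have := (hd e f hef hek).1 (hgain.1 hg)
        rw [this, hef]
        exact CharTwo.add_self_eq_zero _
    · rw [hsum]
      rcases (ht e f h he hf hh).1 (hgain.1 hg) with ⟨rfl, hlab⟩ | ⟨rfl, hlab⟩
      · simp [he, hf, hh, hlab]
        split_ifs <;> simp [one]
      · simp [he, hf, hh, hlab]
        split_ifs <;> simp [one]
  intro v l hl hs
  have main' := fun h0 => main h0 v l hl
  rcases classify m hl hs g with ⟨e, f, hef, hsum, hgain⟩ | ⟨e, f, h, he, hf, hh, hsum, hgain⟩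
  · rw [hgain]
    by_cases hek : e.1 = k
    · exact hk e f hek (hef ▸ hek)
    · rw [hd e f hef hek]
      have := main' (lab e)
      rw [hsum] at this
      have hfk : f.1 ≠ k := hef ▸ hek
      by_contra hne
      simp [hek, hfk, Ne.symm hne] at this
  · rw [hgain, ht e f h he hf hh]
    have := main' (lab e)
    rw [hsum] at this
    by_contra hne
    rcases hk0 with rfl | rfl
    · have hne' : ¬ lab h = lab e := fun h' => hne (Or.inl ⟨rfl, h'.symm⟩)
      simp [he, hf, hh, hne'] at this
    · have hne' : ¬ lab f = lab e := fun h' => hne (Or.inr ⟨rfl, h'.symm⟩)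
      simp [he, hf, hh, hne'] at this

/-- The circle test is valid if all edges of class `2` have equal gain. -/
theorem balanced_of_two (m : Fin 3 → ℕ) {G : Type} [Group G] (g : (multiCircle 3 m).E → G)
    {B : Set ((multiCircle 3 m).E →₀ ZMod 2)}
    (hB : (multiCircle 3 m).IsCycleBasis B)
    (hbal : ∀ c ∈ B, (multiCircle 3 m).IsBalancedCircleCycle g c)
    (γ : G) (hγ : ∀ e : (multiCircle 3 m).E, e.1 = 2 → g e = γ) :
    (multiCircle 3 m).IsBalanced g := by
  refine labels m g hB hbal 2 (Or.inr rfl)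
    (fun e => if e.1 = 0 then g e else (g e * γ)⁻¹) ?_ ?_ ?_
  · intro e f he hf
    rw [hγ e he, hγ f hf]
  · intro e f hef _
    by_cases h0 : e.1 = 0
    · simp [h0, ← hef]
    · simp [h0, ← hef]
  · intro e f h he hf hh
    simp [he, hf, hγ h hh, mul_assoc, mul_eq_one_iff_eq_inv]

/-- The circle test is valid if all edges of class `1` have equal gain. -/
theorem balanced_of_one (m : Fin 3 → ℕ) {G : Type} [Group G] (g : (multiCircle 3 m).E → G)
    {B : Set ((multiCircle 3 m).E →₀ ZMod 2)}
    (hB : (multiCircle 3 m).IsCycleBasis B)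
    (hbal : ∀ c ∈ B, (multiCircle 3 m).IsBalancedCircleCycle g c)
    (γ : G) (hγ : ∀ e : (multiCircle 3 m).E, e.1 = 1 → g e = γ) :
    (multiCircle 3 m).IsBalanced g := by
  refine labels m g hB hbal 1 (Or.inl rfl)
    (fun e => if e.1 = 0 then g e else (γ * g e)⁻¹) ?_ ?_ ?_
  · intro e f he hf
    rw [hγ e he, hγ f hf]
  · intro e f hef _
    by_cases h0 : e.1 = 0
    · simp [h0, ← hef]
    · simp [h0, ← hef]
  · intro e f h he hf hh
    simp [he, hh, hγ f hf, mul_assoc, mul_eq_one_iff_eq_inv]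

/-- In `C₃(m, 2, 2)`, a basis of balanced circles forces one of the doubled edges to be
balanced. -/
theorem digon_balanced (m : ℕ) {G : Type} [Group G]
    (g : (multiCircle 3 ![m, 2, 2]).E → G)
    {B : Set ((multiCircle 3 ![m, 2, 2]).E →₀ ZMod 2)}
    (hB : (multiCircle 3 ![m, 2, 2]).IsCycleBasis B)
    (hbal : ∀ c ∈ B, (multiCircle 3 ![m, 2, 2]).IsBalancedCircleCycle g c) 
    (b c : Fin 2 → G)
    (hb : ∀ j : Fin 2, g ⟨1, j⟩ = b j) (hc : ∀ j : Fin 2, g ⟨2, j⟩ = c j) :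
    b 0 = b 1 ∨ c 0 = c 1 := by
  by_contra hcon
  push Not at hcon
  obtain ⟨hb01, hc01⟩ := hcon
  let x : (multiCircle 3 ![m, 2, 2]).E → ZMod 2 := fun e =>
    if e.1 = 0 then (if g e = (b 0 * c 0)⁻¹ ∨ g e = (b 1 * c 1)⁻¹ then 0 else 1)
    else (e.2.val : ZMod 2)
  have hwalk : (multiCircle 3 ![m, 2, 2]).IsWalkFrom (1 : Fin 3) (1 : Fin 3)
      [(⟨1, (0 : Fin 2)⟩, true), (⟨1, (1 : Fin 2)⟩, false)] := by
    rw [isWalkFrom_cons_iff, isWalkFrom_cons_iff, isWalkFrom_nil_iff]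
    simp [stepStart, stepEnd]
  have hzero : (multiCircle 3 ![m, 2, 2]).walkSum x
      [(⟨1, (0 : Fin 2)⟩, true), (⟨1, (1 : Fin 2)⟩, false)] = 0 := by
    refine key hB hbal x ?_ hwalk
    intro v l hl hs hg
    rcases classify _ hl hs g with
      ⟨e, f, hef, hsum, hgain⟩ | ⟨e, f, h, he, hf, hh, hsum, hgain⟩
    · rw [hsum]
      have hgef := hgain.1 hg
      have hxx : x e = x f := by
        obtain ⟨i, e⟩ := e
        obtain ⟨i', f⟩ := f
        obtain rfl : i = i' := hef
        fin_cases i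
        · change g ⟨0, e⟩ = g ⟨0, f⟩ at hgef
          change x ⟨0, e⟩ = x ⟨0, f⟩
          simp only [x, hgef, if_true]
        · change Fin 2 at e f
          have h1 : b e = b f := by rw [← hb, ← hb]; exact hgef
          have : e = f := by
            fin_cases e <;> fin_cases f <;> simp_all
          rw [this]
        · change Fin 2 at e f
          have h1 : c e = c f := by rw [← hc, ← hc]; exact hgef
          have : e = f := by
            fin_cases e <;> fin_cases f <;> simp_all
          rw [this]
      rw [hxx]
      exact CharTwo.add_self_eq_zero _
    · rw [hsum]
      have hg3 := hgain.1 hg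
      obtain ⟨i, f⟩ := f
      obtain rfl : i = 1 := hf
      obtain ⟨i, h⟩ := h
      obtain rfl : i = 2 := hh
      change Fin 2 at f h
      rw [show g ⟨1, f⟩ = b f from hb f, show g ⟨2, h⟩ = c h from hc h, mul_assoc,
        mul_eq_one_iff_eq_inv] at hg3
      have one : (1 : ZMod 2) + 1 = 0 := rfl
      simp only [x, he, hg3, if_true]
      fin_cases f <;> fin_cases h <;> simp_all [eq_comm]
  simp [walkSum, x] at hzero

end MGraph

/-- For every `m ≥ 2` and every class `𝒢` of groups, the graph
`C₃(m, 2, 2)` is good with respect to `𝒢`; and for all `m, m′ ≥ 1` the graph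
`C₃(m, m′, 1)` is good with respect to every class `𝒢`. -/
theorem c3_graphs_good (𝒢 : GroupClass) :
    (∀ m : ℕ, 2 ≤ m → (MGraph.multiCircle 3 ![m, 2, 2]).CircleTestValidFor 𝒢) ∧
    (∀ m m' : ℕ, 1 ≤ m → 1 ≤ m' →
      (MGraph.multiCircle 3 ![m, m', 1]).CircleTestValidFor 𝒢) := by
  constructor
  · rintro m - G _ - g ⟨B, hB, hbal⟩
    rcases MGraph.digon_balanced m g hB hbal (fun j => g ⟨1, j⟩) (fun j => g ⟨2, j⟩)
      (fun _ => rfl) (fun _ => rfl) with h | h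
    · refine MGraph.balanced_of_one _ g hB hbal (g ⟨1, (0 : Fin 2)⟩) ?_
      rintro ⟨i, e⟩ hi
      obtain rfl : i = 1 := hi
      change Fin 2 at e
      fin_cases e
      · rfl
      · exact h.symm
    · refine MGraph.balanced_of_two _ g hB hbal (g ⟨2, (0 : Fin 2)⟩) ?_
      rintro ⟨i, e⟩ hi
      obtain rfl : i = 2 := hi
      change Fin 2 at e
      fin_cases e
      · rfl
      · exact h.symm
  · rintro m m' - - G _ - g ⟨B, hB, hbal⟩
    refine MGraph.balanced_of_two _ g hB hbal (g ⟨2, (0 : Fin 1)⟩) ?_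
    rintro ⟨i, e⟩ hi
    obtain rfl : i = 2 := hi
    change Fin 1 at e
    fin_cases e
    rfl
end

section
/- Let B be a basis of Z₁(W₄; ℤ₂) consisting of circles, other than the basis B₅ consisting of the four Hamiltonian circles of W₄. If (W₄, g, G) is a gain graph in which every circle in B is balanced, then (W₄, g, G) is balanced. -/
set_option maxHeartbeats 1000000
set_option synthInstance.maxHeartbeats 400000

attribute [local instance] Classical.propDecidable

attribute [local instance] instDecidableEqBool

namespace W4

abbrev S : Type := (Fin 4 ⊕ Fin 4) × Bool

/-- Vertex code. -/
def venc : Fin 4 ⊕ Unit → Nat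
  | .inl i => i.1
  | .inr _ => 4

def sStart : S → Nat
  | (.inl i, true) => i.1
  | (.inl i, false) => (i.1 + 1) % 4
  | (.inr _, true) => 4
  | (.inr i, false) => i.1

def sEnd : S → Nat
  | (.inl i, false) => i.1
  | (.inl i, true) => (i.1 + 1) % 4
  | (.inr _, false) => 4
  | (.inr i, true) => i.1

def idx : List (Fin 4) := [0, 1, 2, 3]

theorem mem_idx (i : Fin 4) : i ∈ idx := by
  fin_cases i <;> simp [idx]

def allSteps (f : S → Bool) : Bool :=
  idx.all fun i => f (.inl i, true) && f (.inl i, false) && f (.inr i, true) && f (.inr i, false)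

theorem allSteps_spec {f : S → Bool} (h : allSteps f = true) (s : S) : f s = true := by
  have h2 := List.all_eq_true.1 h
  rcases s with ⟨i | i, b⟩ <;> have h3 := h2 i (mem_idx i) <;>
    simp only [Bool.and_eq_true] at h3 <;> cases b <;> tauto

/-- `f` holds for all walks from `v` of length at most `n` whose starting vertices are distinct
and avoid `vis`. -/
def allP : Nat → List Nat → Nat → (Nat → List S → Bool) → Bool
  | 0, _, v, f => f v []
  | n + 1, vis, v, f => f v [] && (vis.any (fun u => Nat.beq u v) ||
      allSteps fun s => !(Nat.beq (sStart s) v) ||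
        allP n (v :: vis) (sEnd s) (fun b l => f b (s :: l)))

theorem start_eq (s : S) : venc ((MGraph.wheel 4).stepStart s) = sStart s := by
  rcases s with ⟨i | i, b⟩ <;> cases b <;> simp [MGraph.stepStart, venc, sStart]

theorem end_eq (s : S) : venc ((MGraph.wheel 4).stepEnd s) = sEnd s := by
  rcases s with ⟨i | i, b⟩ <;> cases b <;> simp [MGraph.stepEnd, venc, sEnd]

theorem venc_inj : Function.Injective venc := by
  intro a b h
  rcases a with a | a <;> rcases b with b | b <;> simp [venc] at h ⊢ <;> omega

theorem walk_nil {Γ : MGraph} {v b : Γ.V} (h : Γ.IsWalkFrom v b []) : v = b := by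
  cases h; rfl

theorem walk_cons {Γ : MGraph} {v b : Γ.V} {s : Γ.Step} {l : List Γ.Step}
    (h : Γ.IsWalkFrom v b (s :: l)) : Γ.stepStart s = v ∧ Γ.IsWalkFrom (Γ.stepEnd s) b l := by
  cases h with
  | cons h1 h2 => exact ⟨h1, h2⟩

theorem allP_spec (n : Nat) : ∀ (vis : List Nat) (v b : Fin 4 ⊕ Unit) (f : Nat → List S → Bool)
    (l : List S), allP n vis (venc v) f = true → (MGraph.wheel 4).IsWalkFrom v b l →
    (l.map (MGraph.wheel 4).stepStart).Nodup →
    (∀ s ∈ l, venc ((MGraph.wheel 4).stepStart s) ∉ vis) → l.length ≤ n → f (venc b) l = true := by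
  induction n with
  | zero =>
    intro vis v b f l h hw _ _ hl
    have : l = [] := List.length_eq_zero_iff.1 (by omega)
    subst this
    have := walk_nil hw
    subst this
    exact h
  | succ n ih =>
    intro vis v b f l h hw hn hd hl
    simp only [allP, Bool.and_eq_true, Bool.or_eq_true] at h
    cases l with
    | nil =>
      have := walk_nil hw
      subst this
      exact h.1
    | cons s l =>
      obtain ⟨hs, hw⟩ := walk_cons hw
      have hvis : venc v ∉ vis := by
        have := hd s (by simp)
        rwa [hs] at this
      rcases h.2 with h2 | h2
      · exfalso
        obtain ⟨u, hu, hu2⟩ := List.any_eq_true.1 h2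
        exact hvis (Nat.eq_of_beq_eq_true hu2 ▸ hu)
      · have h3 := allSteps_spec h2 s
        have hb : Nat.beq (sStart s) (venc v) = true := by
          rw [← start_eq, hs]; simp
        rw [hb] at h3
        simp only [Bool.not_true, Bool.false_or] at h3
        rw [← end_eq] at h3
        simp only [List.map_cons, List.nodup_cons] at hn
        refine ih _ _ b (fun b l => f b (s :: l)) l h3 hw hn.2 ?_ (by simpa using hl)
        intro s' hs' hmem
        rcases List.mem_cons.1 hmem with h4 | h4
        · apply hn.1
          rw [hs, ← venc_inj h4]
          exact List.mem_map_of_mem hs'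
        · exact hd s' (by simp [hs']) h4

/-- Interval of rim edges: `k+1` edges starting with `i`. -/
def IW : Fin 4 → Nat → List (Fin 4)
  | i, 0 => [i]
  | i, k + 1 => i :: IW (i + 1) k

def feq (i j : Fin 4) : Bool := Nat.beq i.1 j.1

theorem feq_iff (i j : Fin 4) : feq i j = true ↔ i = j := by
  simp [feq, Fin.ext_iff]

def eqE : Fin 4 ⊕ Fin 4 → Fin 4 ⊕ Fin 4 → Bool
  | .inl i, .inl j => feq i j
  | .inr i, .inr j => feq i j
  | _, _ => false

theorem eqE_iff (e f : Fin 4 ⊕ Fin 4) : eqE e f = true ↔ e = f := by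
  rcases e with e | e <;> rcases f with f | f <;> simp [eqE, feq_iff]

/-- edge set of the circle with rim interval `(i,k)`. -/
def vec (i k : Fin 4) : Fin 4 ⊕ Fin 4 → Bool
  | .inl x => (IW i k.1).any (fun y => feq x y)
  | .inr x => xor (feq x i) (feq x (i + k + 1))

def par : List S → Fin 4 ⊕ Fin 4 → Bool
  | [], _ => false
  | s :: l, e => xor (eqE s.1 e) (par l e)

def rimWord : List S → List (Fin 4 × Bool)
  | [] => []
  | (.inl i, b) :: l => (i, b) :: rimWord l
  | (.inr _, _) :: l => rimWord l

def leq : List (Fin 4 × Bool) → List (Fin 4 × Bool) → Bool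
  | [], [] => true
  | x :: l, y :: m => feq x.1 y.1 && !(xor x.2 y.2) && leq l m
  | _, _ => false

theorem leq_eq : ∀ l m, leq l m = true → l = m
  | [], [], _ => rfl
  | [], _ :: _, h => by simp [leq] at h
  | _ :: _, [], h => by simp [leq] at h
  | (x, b) :: l, (y, c) :: m, h => by
    simp only [leq, Bool.and_eq_true, feq_iff] at h
    obtain ⟨⟨h1, h2⟩, h3⟩ := h
    have := leq_eq l m h3
    subst this
    subst h1
    cases b <;> cases c <;> simp at h2 ⊢

def posWord (i k r : Fin 4) : List (Fin 4 × Bool) :=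
  ((IW i k.1).drop r.1 ++ (IW i k.1).take r.1).map fun x => (x, true)

def negWord (i k r : Fin 4) : List (Fin 4 × Bool) :=
  ((IW i k.1).drop r.1 ++ (IW i k.1).take r.1).reverse.map fun x => (x, false)

def good (l : List S) : Bool :=
  idx.any fun i => idx.any fun k => 
    (idx.all fun x => !(xor (par l (.inl x)) (vec i k (.inl x))) &&
      !(xor (par l (.inr x)) (vec i k (.inr x)))) &&
    idx.any fun r => leq (rimWord l) (posWord i k r) || leq (rimWord l) (negWord i k r)

def isDig : List S → Bool
  | [] => true
  | [s, t] => eqE s.1 t.1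
  | _ => false

def testW (v b : Nat) (l : List S) : Bool := !(Nat.beq v b) || isDig l || good l

def vs : List (Fin 4 ⊕ Unit) := [.inl 0, .inl 1, .inl 2, .inl 3, .inr ()]

def bigTest : Bool := vs.all fun v => allP 5 [] (venc v) (testW (venc v))

theorem bigTest_true : bigTest = true := by decide +kernel

theorem classify (v : Fin 4 ⊕ Unit) (l : List S) (hw : (MGraph.wheel 4).IsWalkFrom v v l)
    (hs : (MGraph.wheel 4).IsSimpleClosed l) :
    ∃ i k r : Fin 4, (∀ e, par l e = vec i k e) ∧
      (rimWord l = posWord i k r ∨ rimWord l = negWord i k r) := by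
  obtain ⟨h1, h2, h3⟩ := hs
  have hv : v ∈ vs := by
    rcases v with v | v
    · fin_cases v <;> simp [vs]
    · simp [vs]
  have hb := List.all_eq_true.1 bigTest_true v hv
  have hlen : l.length ≤ 5 := by
    have := List.Nodup.length_le_card h3
    simpa using this
  have ht := allP_spec 5 [] v v _ l hb hw h3 (by simp) hlen
  have hg : good l = true := by
    simp only [testW, Bool.or_eq_true] at ht
    rcases ht with (ht | ht) | ht
    · simp at ht
    · exfalso
      rcases l with _ | ⟨s, _ | ⟨t, _ | ⟨u, l⟩⟩⟩
      · exact h1 rfl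
      · simp [isDig] at ht
      · simp [isDig, eqE_iff] at ht
        simp [MGraph.walkEdges, ht] at h2
      · simp [isDig] at ht
    · exact ht
  simp only [good, List.any_eq_true, Bool.and_eq_true, List.all_eq_true, Bool.or_eq_true] at hg
  obtain ⟨i, -, k, -, h4, r, -, h5⟩ := hg
  refine ⟨i, k, r, ?_, h5.imp (leq_eq _ _) (leq_eq _ _)⟩
  intro e
  rcases e with x | x
  · have := (h4 x (mem_idx x)).1
    revert this
    cases par l (.inl x) <;> cases vec i k (.inl x) <;> simp
  · have := (h4 x (mem_idx x)).2
    revert this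
    cases par l (.inr x) <;> cases vec i k (.inr x) <;> simp

theorem count_par (l : List S) (e : Fin 4 ⊕ Fin 4) :
    ((countIn ((MGraph.wheel 4).walkEdges l) e : ℕ) : ZMod 2) = if par l e = true then 1 else 0 := by
  induction l with
  | nil => simp [countIn, MGraph.walkEdges, par]
  | cons s l ih =>
    simp only [countIn, MGraph.walkEdges, List.map_cons, List.sum_cons, Nat.cast_add, par] at ih ⊢
    rw [ih]
    by_cases h : s.1 = e
    · have h' : eqE s.1 e = true := (eqE_iff _ _).2 h
      simp only [h', if_pos h]
      cases par l e
      · simp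
      · simp; rfl
    · have h' : eqE s.1 e = false := by
        rw [← Bool.not_eq_true, eqE_iff]; exact h
      simp [h', if_neg h]

section gains

variable {G : Type} [Group G] (g : Fin 4 ⊕ Fin 4 → G)

def pot : Fin 4 ⊕ Unit → G
  | .inl i => g (.inr i)
  | .inr _ => 1

def aa (i : Fin 4) : G := g (.inr i) * g (.inl i) * (g (.inr (i + 1)))⁻¹

def ev (x : Fin 4 × Bool) : G := if x.2 = true then aa g x.1 else (aa g x.1)⁻¹

theorem succ_eq (i : Fin 4) : (⟨(i.1 + 1) % 4, Nat.mod_lt _ i.pos⟩ : Fin 4) = i + 1 := by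
  fin_cases i <;> rfl

theorem gain_eq {v b : Fin 4 ⊕ Unit} {l : List S} (hw : (MGraph.wheel 4).IsWalkFrom v b l) :
    (MGraph.wheel 4).walkGain g l = (pot g v)⁻¹ * ((rimWord l).map (ev g)).prod * pot g b := by
  induction l generalizing v with
  | nil =>
    have := walk_nil hw
    subst this
    simp [MGraph.walkGain, rimWord]
  | cons s l ih =>
    obtain ⟨hs, hw'⟩ := walk_cons hw
    subst hs
    have ih := ih hw'
    simp only [MGraph.walkGain, List.map_cons, List.prod_cons] at ih ⊢
    rw [ih]
    rcases s with ⟨i | i, c⟩ <;> cases c <;>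
      simp [MGraph.stepGain, MGraph.stepStart, MGraph.stepEnd, rimWord, pot, ev, aa, succ_eq,
        mul_assoc]

def Wg (i k : Fin 4) : G := ((IW i k.1).map (aa g)).prod

theorem rot_one (x : List G) (r : Nat) (h : (x.drop r ++ x.take r).prod = 1) : x.prod = 1 := by
  rw [List.prod_append] at h
  rw [← List.take_append_drop r x, List.prod_append]
  exact mul_eq_one_iff_eq_inv.2 (mul_eq_one_iff_eq_inv'.1 h)

theorem pos_one (i k r : Fin 4) (h : ((posWord i k r).map (ev g)).prod = 1) : Wg g i k = 1 := by
  apply rot_one _ r.1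
  rw [← h, posWord, List.map_map, ← List.map_drop, ← List.map_take, ← List.map_append]
  rfl

theorem neg_one (i k r : Fin 4) (h : ((negWord i k r).map (ev g)).prod = 1) : Wg g i k = 1 := by
  apply rot_one _ r.1
  rw [← inv_eq_one, ← h, negWord, List.map_map, ← List.map_drop, ← List.map_take,
    ← List.map_append, List.prod_inv_reverse, List.map_map, List.map_reverse]
  rfl

end gains

/-! Final finite closure check. -/

def allB (f : Bool → Bool) : Bool := f true && f false

theorem allB_spec {f : Bool → Bool} (h : allB f = true) (b : Bool) : f b = true := by
  simp only [allB, Bool.and_eq_true] at h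
  cases b
  · exact h.2
  · exact h.1

def two3 (a b c : Bool) : Bool :=
  (!(a && b) || c) && (!(a && c) || b) && (!(b && c) || a)

def rules (t : Fin 4 → Fin 4 → Bool) : Bool :=
  idx.all fun i => two3 (t i 1) (t i 0) (t (i + 1) 0) &&
    two3 (t i 2) (t i 0) (t (i + 1) 1) && two3 (t i 2) (t i 1) (t (i + 2) 0) &&
    two3 (t i 3) (t i 0) (t (i + 1) 2) && two3 (t i 3) (t i 1) (t (i + 2) 1) &&
    two3 (t i 3) (t i 2) (t (i + 3) 0)

def dotB (p : Fin 4 → Bool) (i k : Fin 4) : Bool :=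
  xor (xor (p 0 && vec i k (.inl 0)) (p 1 && vec i k (.inl 1)))
    (xor (p 2 && vec i k (.inl 2)) (p 3 && vec i k (.inl 3)))

def mk4 (a b c d : Bool) : Fin 4 → Bool := fun i =>
  match i.1 with
  | 0 => a
  | 1 => b
  | 2 => c
  | _ => d

def clauses (t : Fin 4 → Fin 4 → Bool) : Bool :=
  allB fun a => allB fun b => allB fun c => allB fun d =>
    !(a || b || c || d) || idx.any fun i => idx.any fun k => t i k && dotB (mk4 a b c d) i k

def nonH (t : Fin 4 → Fin 4 → Bool) : Bool :=
  idx.any fun i => t i 0 || t i 1 || t i 3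

def tt (x y z : Fin 4 → Bool) (w : Bool) : Fin 4 → Fin 4 → Bool := fun i k =>
  match k.1 with
  | 0 => x i
  | 1 => y i
  | 2 => z i
  | _ => w

def all4 (f : (Fin 4 → Bool) → Bool) : Bool :=
  allB fun a => allB fun b => allB fun c => allB fun d => f (mk4 a b c d)

theorem mk4_eta (x : Fin 4 → Bool) : mk4 (x 0) (x 1) (x 2) (x 3) = x := by
  funext i; fin_cases i <;> rfl

theorem all4_spec {f : (Fin 4 → Bool) → Bool} (h : all4 f = true) (x : Fin 4 → Bool) :
    f x = true := by
  have := allB_spec (allB_spec (allB_spec (allB_spec h (x 0)) (x 1)) (x 2)) (x 3)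
  rwa [mk4_eta] at this

def closureTest : Bool :=
  all4 fun x => all4 fun y => all4 fun z => allB fun w =>
    !(rules (tt x y z w)) || !(nonH (tt x y z w)) || !(clauses (tt x y z w)) ||
      (x 0 && x 1 && x 2 && x 3)

theorem closureTest_true : closureTest = true := by decide +kernel

theorem closure_all (t : Fin 4 → Fin 4 → Bool) (hw : ∀ i, t i 3 = t 0 3) (h1 : rules t = true)
    (h2 : nonH t = true) (h3 : clauses t = true) (i : Fin 4) : t i 0 = true := by
  have ht : tt (fun i => t i 0) (fun i => t i 1) (fun i => t i 2) (t 0 3) = t := by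
    funext i k
    fin_cases k
    · rfl
    · rfl
    · rfl
    · exact (hw i).symm
  have h := allB_spec (all4_spec (all4_spec (all4_spec closureTest_true (fun i => t i 0))
    (fun i => t i 1)) (fun i => t i 2)) (t 0 3)
  rw [ht, h1, h2, h3] at h
  simp only [Bool.not_true, Bool.false_or, Bool.and_eq_true] at h
  fin_cases i
  · exact h.1.1.1
  · exact h.1.1.2
  · exact h.1.2
  · exact h.2

def cf (b : Bool) : ZMod 2 := if b = true then 1 else 0

/-- linear functional reading the rim coordinates. -/
noncomputable def fnl (p : Fin 4 → Bool) : ((Fin 4 ⊕ Fin 4) →₀ ZMod 2) →ₗ[ZMod 2] ZMod 2 :=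
  cf (p 0) • Finsupp.lapply (Sum.inl 0) + cf (p 1) • Finsupp.lapply (Sum.inl 1) +
  cf (p 2) • Finsupp.lapply (Sum.inl 2) + cf (p 3) • Finsupp.lapply (Sum.inl 3)

theorem fnl_apply (p : Fin 4 → Bool) (c : (Fin 4 ⊕ Fin 4) →₀ ZMod 2) :
    fnl p c = cf (p 0) * c (.inl 0) + cf (p 1) * c (.inl 1) + cf (p 2) * c (.inl 2) +
      cf (p 3) * c (.inl 3) := rfl

noncomputable def tri (i : Fin 4) : (Fin 4 ⊕ Fin 4) →₀ ZMod 2 :=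
  Finsupp.single (.inl i) 1 + Finsupp.single (.inr i) 1 + Finsupp.single (.inr (i + 1)) 1

theorem tri_mem (i : Fin 4) : tri i ∈ (MGraph.wheel 4).cycleSpace := by
  rw [MGraph.cycleSpace, LinearMap.mem_ker]
  have h2 : ∀ x : (Fin 4 ⊕ Unit) →₀ ZMod 2, x + x = 0 := by
    intro x; ext j
    exact CharTwo.add_self_eq_zero _
  simp only [tri, map_add, MGraph.boundary, Finsupp.lsum_single, LinearMap.add_apply,
    Finsupp.lsingle_apply, succ_eq]
  generalize (Finsupp.single (Sum.inl i) 1 : (Fin 4 ⊕ Unit) →₀ ZMod 2) = a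
  generalize (Finsupp.single (Sum.inl (i + 1)) 1 : (Fin 4 ⊕ Unit) →₀ ZMod 2) = b
  generalize (Finsupp.single (Sum.inr ()) 1 : (Fin 4 ⊕ Unit) →₀ ZMod 2) = c
  calc a + b + (c + a) + (c + b) = (a + a) + (b + b) + (c + c) := by abel
    _ = 0 := by rw [h2 a, h2 b, h2 c]; simp

theorem fnl_tri (p : Fin 4 → Bool) (i : Fin 4) (h : p i = true) : fnl p (tri i) = 1 := by
  have : ∀ j : Fin 4, tri i (.inl j) = if j = i then 1 else 0 := by
    intro j
    by_cases hj : j = i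
    · subst hj; simp [tri]
    · simp [tri, hj, Finsupp.single_apply, Ne.symm hj, eq_comm]
  rw [fnl_apply]
  simp only [this]
  fin_cases i <;> simp_all [cf]

theorem fnl_vec (p : Fin 4 → Bool) (i k : Fin 4) (c : (Fin 4 ⊕ Fin 4) →₀ ZMod 2)
    (hc : ∀ e, c e = if vec i k e = true then 1 else 0) (h : fnl p c ≠ 0) :
    dotB p i k = true := by
  revert h
  simp only [fnl_apply, hc, dotB]
  generalize vec i k (.inl 0) = a0
  generalize vec i k (.inl 1) = a1
  generalize vec i k (.inl 2) = a2
  generalize vec i k (.inl 3) = a3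
  have h2 : (1 : ZMod 2) + 1 = 0 := by rfl
  cases p 0 <;> cases p 1 <;> cases p 2 <;> cases p 3 <;> cases a0 <;> cases a1 <;>
    cases a2 <;> cases a3 <;> simp [h2, cf]

end W4

open W4

/-- Let `B` be a circle basis of `Z₁(W₄; ℤ₂)` other than the
basis `B₅` of Hamiltonian circles.  If `(W₄, g, G)` is a gain graph in which
every circle of `B` is balanced, then it is balanced. -/
theorem w4_non_hamiltonian_basis_implies_balance (G : Type) [Group G]
    (g : (MGraph.wheel 4).E → G)
    (B : Set ((MGraph.wheel 4).E →₀ ZMod 2))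
    (hB : (MGraph.wheel 4).IsCycleBasis B)
    (hcirc : ∀ c ∈ B, (MGraph.wheel 4).IsCircleCycle c)
    (hne : B ≠ MGraph.wheelHamBasis 4)
    (hbal : ∀ c ∈ B, (MGraph.wheel 4).IsBalancedCircleCycle g c) :
    (MGraph.wheel 4).IsBalanced g := by
  have key : ∀ c ∈ B, ∃ i k : Fin 4, (∀ e, c e = if vec i k e = true then 1 else 0) ∧
      Wg g i k = 1 := by
    intro c hc
    obtain ⟨l, hs, ⟨⟨v, hw⟩, hce⟩, hgain⟩ := hbal c hc
    obtain ⟨i, k, r, hp, hword⟩ := classify v l hw hs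
    refine ⟨i, k, fun e => ?_, ?_⟩
    · rw [hce e, ← hp e]
      exact count_par l e
    · rw [gain_eq g hw] at hgain
      have h1 : ((rimWord l).map (ev g)).prod = 1 := by
        rw [mul_assoc, inv_mul_eq_one] at hgain
        exact right_eq_mul.1 hgain
      rcases hword with h | h
      · exact pos_one g i k r (h ▸ h1)
      · exact neg_one g i k r (h ▸ h1)
  have hspan : ∀ p : Fin 4 → Bool, (∃ i, p i = true) → ∃ c ∈ B, fnl p c ≠ 0 := by
    rintro p ⟨i, hi⟩
    by_contra! hcon
    have hle : Submodule.span (ZMod 2) B ≤ LinearMap.ker (fnl p) :=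
      Submodule.span_le.2 fun c hc => LinearMap.mem_ker.2 (hcon c hc)
    have := LinearMap.mem_ker.1 (hle (hB.2.2 _ (tri_mem i)))
    rw [fnl_tri p i hi] at this
    exact one_ne_zero this
  let t : Fin 4 → Fin 4 → Bool := fun i k => decide (Wg g i k = 1)
  have hrules : rules t = true := by
    have two3_mul : ∀ x y z : G, x = y * z →
        two3 (decide (x = 1)) (decide (y = 1)) (decide (z = 1)) = true := by
      intro x y z h
      by_cases hy : y = 1 <;> by_cases hz : z = 1 <;> simp [h, hy, hz, two3]
    simp only [rules, List.all_eq_true, Bool.and_eq_true]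
    intro i _
    refine ⟨⟨⟨⟨⟨?_, ?_⟩, ?_⟩, ?_⟩, ?_⟩, ?_⟩ <;> apply two3_mul <;> fin_cases i <;>
      simp [Wg, IW, mul_assoc]
  have hw3 : ∀ i, t i 3 = t 0 3 := by
    intro i
    have : Wg g i 3 = 1 ↔ Wg g 0 3 = 1 := by
      have hr : IW i 3 = (IW 0 3).rotate i.1 := by fin_cases i <;> rfl
      have hr2 : (IW i 3).rotate (4 - i.1) = IW 0 3 := by fin_cases i <;> rfl
      constructor
      · intro h
        have := List.prod_rotate_eq_one_of_prod_eq_one h (4 - i.1)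
        rwa [← List.map_rotate, show ((3 : Fin 4) : ℕ) = 3 from rfl, hr2] at this
      · intro h
        have := List.prod_rotate_eq_one_of_prod_eq_one h i.1
        rwa [← List.map_rotate, show ((3 : Fin 4) : ℕ) = 3 from rfl, ← hr] at this
    simp only [t, this]
  have hcl : clauses t = true := by
    have h : ∀ a b c d : Bool, (!(a || b || c || d) ||
        idx.any fun i => idx.any fun k => t i k && dotB (mk4 a b c d) i k) = true := by
      intro a b c d
      by_cases hz : (a || b || c || d) = true
      · have hex : ∃ i, mk4 a b c d i = true := by
          simp only [Bool.or_eq_true] at hz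
          rcases hz with ((hz | hz) | hz) | hz
          · exact ⟨0, hz⟩
          · exact ⟨1, hz⟩
          · exact ⟨2, hz⟩
          · exact ⟨3, hz⟩
        obtain ⟨x, hx, hx2⟩ := hspan _ hex
        obtain ⟨i, k, h1, h2⟩ := key x hx
        rw [Bool.or_eq_true]
        right
        refine List.any_eq_true.2 ⟨i, mem_idx i, List.any_eq_true.2 ⟨k, mem_idx k, ?_⟩⟩
        rw [Bool.and_eq_true]
        exact ⟨by simp [t, h2], fnl_vec _ i k x h1 hx2⟩
      · simp only [Bool.not_eq_true] at hz
        rw [hz]; rfl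
    simp only [clauses, allB, h, Bool.and_self]
  have hnon : nonH t = true := by
    by_contra hcon
    have hcon' : ∀ i k, Wg g i k = 1 → k = 2 := by
      intro i k h
      by_contra hk
      apply hcon
      refine List.any_eq_true.2 ⟨i, mem_idx i, ?_⟩
      fin_cases k <;> simp_all [t]
    have key2 : ∀ c ∈ B, ∃ i : Fin 4, (∀ e, c e = if vec i 2 e = true then 1 else 0) := by
      intro c hc
      obtain ⟨i, k, h1, h2⟩ := key c hc
      obtain rfl := hcon' i k h2
      exact ⟨i, h1⟩
    have ham : ∀ (i : Fin 4) (c : (Fin 4 ⊕ Fin 4) →₀ ZMod 2),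
        (∀ e, c e = if vec i 2 e = true then 1 else 0) →
        c = MGraph.indicatorCycle (MGraph.wheel 4) (MGraph.wheelHamSet 4 (i + 3)) := by
      intro i c h
      ext e
      rw [h e]
      have hiff : vec i 2 e = true ↔ e ∈ MGraph.wheelHamSet 4 (i + 3) := by
        rcases e with e | e <;> fin_cases i <;> fin_cases e <;>
          simp [vec, MGraph.wheelHamSet, IW, feq] <;> rfl
      simp only [MGraph.indicatorCycle, Finsupp.equivFunOnFinite_symm_apply_apply, hiff]
    apply hne
    ext c
    constructor
    · intro hc
      obtain ⟨i, hi⟩ := key2 c hc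
      exact ⟨i + 3, ham i c hi⟩
    · rintro ⟨r, rfl⟩
      obtain ⟨c, hc, hc2⟩ := hspan (fun j => !(feq j r))
        ⟨r + 1, by fin_cases r <;> rfl⟩
      obtain ⟨i, hi⟩ := key2 c hc
      have hd := fnl_vec _ i 2 c hi hc2
      have hir : i + 3 = r := by
        clear hi
        revert hd
        fin_cases i <;> fin_cases r <;> simp [dotB, vec, IW, feq] <;> rfl
      rw [← hir, ← ham i c hi]
      exact hc
  have hone : ∀ i, aa g i = 1 := by
    intro i
    have := closure_all t hw3 hrules hnon hcl i
    simpa [t, Wg, IW] using this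
  intro v l hw _
  rw [gain_eq g hw]
  have : ((rimWord l).map (ev g)).prod = 1 := by
    apply List.prod_eq_one
    intro x hx
    obtain ⟨y, -, rfl⟩ := List.mem_map.1 hx
    simp [ev, hone]
  rw [this]; simp
end
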